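/- arXiv:1403.2224 — 5 statements merged into one kernel-verified Lean document; each statement's English description precedes it below -/
import Mathlib

section
/- Let p be an odd prime, let k ≥ 2, set q = p^k, and let G = PGL₂(𝔽_q). Let ε = 1 if q ≡ 1 (mod 4) and ε = −1 if q ≡ 3 (mod 4), so that 4 divides q − ε. Suppose: i ∈ G is an involution and T ≤ C_G(i) is a cyclic subgroup of cardinality q − ε; j ∈ G is an involution satisfying j⁻¹·t·j = t⁻¹ for all t ∈ T, whose centralizer C_G(j) has cardinality 2(q − ε); x ∈ G has order 3 and satisfies x⁻¹·i·x = i·j and x⁻¹·j·x = i; and s ∈ T has order 4. Let a be a positive divisor of k, let ε_a ∈ {1, −1} be such that 4 divides p^a − ε_a, and let r ∈ T be an element of order p^a − ε_a. If it is not the case that a = 1 and p = 5, then the subgroup of G generated by {r, x} is isomorphic, as a group, to PGL₂(𝔽_{p^a}). -/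
open Matrix

/-- `PGL₂(F)`: the quotient of `GL₂(F)` by its center. -/
abbrev PGL2 (F : Type*) [Field F] : Type _ :=
  GL (Fin 2) F ⧸ Subgroup.center (GL (Fin 2) F)

/-- A matrix squaring to `-1`. -/
def quatI (F : Type*) [Field F] : Matrix (Fin 2) (Fin 2) F := !![0, -1; 1, 0]

/-- The matrix `a + b * quatI`. -/
def rotMat {F : Type*} [Field F] (a b : F) : Matrix (Fin 2) (Fin 2) F := !![a, -b; b, a]

/-- For `u ^ 2 + v ^ 2 = -1`, a matrix squaring to `-1` and anticommuting with `quatI`. -/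
def quatJ {F : Type*} [Field F] (u v : F) : Matrix (Fin 2) (Fin 2) F := !![u, v; v, -u]

/-- The matrix `1 + I + J + I * J`, which conjugates `I` to `J` and `J` to `I * J`. -/
def quatY {F : Type*} [Field F] (u v : F) : Matrix (Fin 2) (Fin 2) F :=
  !![1 + u - v, -1 + v + u; 1 + v + u, 1 - u + v]

section Generation

variable {K : Type*} [Field K]

/-- The trace zero matrix `a * I + b * J + c * (I * J)`. -/
def pureQuat (u v a b c : K) : Matrix (Fin 2) (Fin 2) K :=
  !![b * u - c * v, -a + b * v + c * u; a + b * v + c * u, -(b * u) + c * v]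

lemma exists_sq_add_eq_sq_add [Finite K] (hK : Odd (Nat.card K)) (hns : ∀ t : K, t ^ 2 ≠ -1)
    {d e : K} (hd : d ≠ 0) (he : e ≠ 0) :
    ∃ b c c' : K, b ^ 2 + c ^ 2 = d ∧ b ^ 2 + c' ^ 2 = e := by
  classical
  have := Fintype.ofFinite K
  rw [Nat.card_eq_fintype_card] at hK
  have h1 : ∀ t : K, 1 + t ^ 2 ≠ 0 := fun t h => hns t (by linear_combination h)
  have key : ∀ d : K, d ≠ 0 → Fintype.card K ≤
      2 * (Finset.univ.filter fun b : K => ∃ c, b ^ 2 + c ^ 2 = d).card := by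
    intro d hd
    obtain ⟨b₀, c₀, h₀⟩ : ∃ b c : K, b ^ 2 + c ^ 2 = d := by
      obtain ⟨a, b, hab⟩ := FiniteField.exists_root_sum_quadratic (R := K)
        (f := Polynomial.X ^ 2) (g := Polynomial.X ^ 2 - Polynomial.C d)
        (Polynomial.degree_X_pow 2) (Polynomial.degree_X_pow_sub_C (by decide) _)
        (Nat.odd_iff.mp hK)
      refine ⟨a, b, ?_⟩
      simp at hab
      linear_combination hab
    rw [← Finset.card_univ]
    refine Finset.card_le_mul_card_image_of_maps_to
      (f := fun t : K => (b₀ * (1 - t ^ 2) - 2 * c₀ * t) / (1 + t ^ 2)) ?_ 2 ?_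
    · intro t _
      simp only [Finset.mem_filter, Finset.mem_univ, true_and]
      refine ⟨(c₀ * (1 - t ^ 2) + 2 * b₀ * t) / (1 + t ^ 2), ?_⟩
      have := h1 t
      field_simp
      rw [← h₀]; ring
    · intro b _
      let f : Polynomial K := Polynomial.C (b + b₀) * Polynomial.X ^ 2 +
        Polynomial.C (2 * c₀) * Polynomial.X + Polynomial.C (b - b₀)
      have hf : f ≠ 0 := by
        intro hf
        have e0 : b - b₀ = 0 := by
          have := congrArg (fun g => Polynomial.coeff g 0) hf
          simpa [f] using this
        have e1 : (2 : K) = 0 ∨ c₀ = 0 := by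
          have := congrArg (fun g => Polynomial.coeff g 1) hf
          simpa [f, -map_add, -map_sub, -map_mul, Polynomial.coeff_X, Polynomial.coeff_C] using this
        have e2 : b + b₀ = 0 := by
          have := congrArg (fun g => Polynomial.coeff g 2) hf
          simpa [f, -map_add, -map_sub, -map_mul, Polynomial.coeff_X, Polynomial.coeff_C] using this
        have h2 : (2 : K) ≠ 0 := by
          intro h; exact hns 1 (by linear_combination h)
        have e3 : b₀ = 0 := by
          have : 2 * b₀ = 0 := by linear_combination e2 - e0
          simpa [h2] using this
        have e4 : c₀ = 0 := by simpa [h2] using e1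
        exact hd (by rw [← h₀, e3, e4]; ring)
      calc _ ≤ f.roots.toFinset.card := by
            refine Finset.card_le_card fun t ht => ?_
            simp only [Finset.mem_filter, Finset.mem_univ, true_and] at ht
            rw [div_eq_iff (h1 t)] at ht
            simp only [Multiset.mem_toFinset, Polynomial.mem_roots hf, Polynomial.IsRoot, f]
            simp
            linear_combination -ht
        _ ≤ f.roots.card := Multiset.toFinset_card_le _
        _ ≤ f.natDegree := Polynomial.card_roots' f
        _ ≤ 2 := Polynomial.natDegree_quadratic_le
  obtain ⟨b, hb⟩ : ((Finset.univ.filter fun b : K => ∃ c, b ^ 2 + c ^ 2 = d) ∩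
      (Finset.univ.filter fun b : K => ∃ c, b ^ 2 + c ^ 2 = e)).Nonempty := by
    apply Finset.inter_nonempty_of_card_lt_card_add_card (s := Finset.univ)
      (Finset.subset_univ _) (Finset.subset_univ _)
    have := key d hd
    have := key e he
    obtain ⟨m, hm⟩ := hK
    rw [Finset.card_univ]
    omega
  simp only [Finset.mem_inter, Finset.mem_filter, Finset.mem_univ, true_and] at hb
  obtain ⟨⟨c, hc⟩, c', hc'⟩ := hb
  exact ⟨b, c, c', hc, hc'⟩

/-- A set of invertible matrices closed under the group operations and nonzero scalars,
containing the torus of `quatI` and `quatY`. -/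
structure RotClosed (u v : K) (Q : Matrix (Fin 2) (Fin 2) K → Prop) : Prop where
  det_ne : ∀ {M}, Q M → M.det ≠ 0
  mul : ∀ {M N}, Q M → Q N → Q (M * N)
  adj : ∀ {M}, Q M → Q M.adjugate
  smul : ∀ {M} {c : K}, c ≠ 0 → Q M → Q (c • M)
  rot : ∀ {a b : K}, a ^ 2 + b ^ 2 ≠ 0 → Q (rotMat a b)
  quatY : Q (quatY u v)

namespace RotClosed

variable {u v : K} {Q : Matrix (Fin 2) (Fin 2) K → Prop}

lemma of_mul_left (hQ : RotClosed u v Q) {M N : Matrix (Fin 2) (Fin 2) K} (hM : Q M)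
    (h : Q (M * N)) : Q N := by
  have := hQ.smul (inv_ne_zero (hQ.det_ne hM)) (hQ.mul (hQ.adj hM) h)
  rwa [← Matrix.mul_assoc, adjugate_mul, smul_mul_assoc, Matrix.one_mul, smul_smul,
    inv_mul_cancel₀ (hQ.det_ne hM), one_smul] at this

/-- `V` can be conjugated to `W` by an element of `Q`. -/
def Reach (Q : Matrix (Fin 2) (Fin 2) K → Prop) (V W : Matrix (Fin 2) (Fin 2) K) : Prop :=
  ∃ g, Q g ∧ g * V = W * g

lemma reach_trans (hQ : RotClosed u v Q) {V W Z : Matrix (Fin 2) (Fin 2) K}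
    (h : Reach Q V W) (h' : Reach Q W Z) : Reach Q V Z := by
  obtain ⟨g, hg, e⟩ := h
  obtain ⟨g', hg', e'⟩ := h'
  refine ⟨g' * g, hQ.mul hg' hg, ?_⟩
  rw [Matrix.mul_assoc, e, ← Matrix.mul_assoc, e', Matrix.mul_assoc]

lemma reach_cycle (hQ : RotClosed u v Q) (huv : u ^ 2 + v ^ 2 = -1) (a b c : K) :
    Reach Q (pureQuat u v a b c) (pureQuat u v c a b) := by
  refine ⟨_, hQ.quatY, ?_⟩
  ext i j
  fin_cases i <;> fin_cases j <;>
    simp [_root_.quatY, pureQuat, Matrix.mul_apply, Fin.sum_univ_two] <;> grind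

lemma reach_rot (hQ : RotClosed u v Q) (hns : ∀ t : K, t ^ 2 ≠ -1) {a b c b' c' : K}
    (h : b ^ 2 + c ^ 2 = b' ^ 2 + c' ^ 2) (h0 : b ^ 2 + c ^ 2 ≠ 0) :
    Reach Q (pureQuat u v a b c) (pureQuat u v a b' c') := by
  have hsum : ∀ y z : K, y ^ 2 + z ^ 2 = 0 → y = 0 ∧ z = 0 := by
    intro y z hyz
    by_cases hz : z = 0
    · subst hz; simpa using hyz
    · exact absurd (by field_simp; linear_combination hyz) (hns (y / z))
  by_cases hn : (b ^ 2 + c ^ 2 + b * b' + c * c') ^ 2 + (c' * b - b' * c) ^ 2 = 0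
  · obtain ⟨e1, e2⟩ := hsum _ _ hn
    have hb : b' = -b := by
      have : (b ^ 2 + c ^ 2) * (b' + b) = 0 := by linear_combination b * e1 - c * e2
      have := (mul_eq_zero.mp this).resolve_left h0
      linear_combination this
    have hc : c' = -c := by
      have : (b ^ 2 + c ^ 2) * (c' + c) = 0 := by linear_combination c * e1 + b * e2
      have := (mul_eq_zero.mp this).resolve_left h0
      linear_combination this
    subst hb hc
    refine ⟨rotMat 0 1, hQ.rot (by simp), ?_⟩
    ext i j
    fin_cases i <;> fin_cases j <;>
      simp [rotMat, pureQuat, Matrix.mul_apply, Fin.sum_univ_two] <;> grind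
  · refine ⟨_, hQ.rot hn, ?_⟩
    ext i j
    fin_cases i <;> fin_cases j <;>
      simp [rotMat, pureQuat, Matrix.mul_apply, Fin.sum_univ_two] <;> grind

lemma reach_of_norm_one [Finite K] (hK : Odd (Nat.card K)) (hQ : RotClosed u v Q)
    (huv : u ^ 2 + v ^ 2 = -1) (hns : ∀ t : K, t ^ 2 ≠ -1) {a b c : K}
    (h : a ^ 2 + b ^ 2 + c ^ 2 = 1) :
    Reach Q (pureQuat u v a b c) (pureQuat u v 1 0 0) := by
  have cyc := fun a b c => hQ.reach_cycle huv a b c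
  have rot := fun {a b c b' c'} => hQ.reach_rot hns (a := a) (b := b) (c := c) (b' := b') (c' := c')
  have zero_case : ∀ y z : K, y ^ 2 + z ^ 2 = 1 →
      Reach Q (pureQuat u v 0 y z) (pureQuat u v 1 0 0) := fun y z hyz =>
    hQ.reach_trans (rot (b' := 0) (c' := 1) (by simp [hyz]) (by simp [hyz])) (cyc _ _ _)
  by_cases ha : a ^ 2 = 1
  · have hbc : b ^ 2 + c ^ 2 = 0 := by linear_combination h - ha
    have hc : c = 0 := by
      by_contra hc
      exact hns (b / c) (by field_simp; linear_combination hbc)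
    have hb : b = 0 := by simpa [hc] using hbc
    subst hb hc
    exact hQ.reach_trans (cyc _ _ _) (zero_case _ _ (by simp [ha]))
  by_cases ha0 : a = 0
  · subst ha0
    exact zero_case _ _ (by linear_combination h)
  obtain ⟨y, z, z', h1, h2⟩ := exists_sq_add_eq_sq_add hK hns
    (d := 1 - a ^ 2) (e := 1) (fun e => ha (by linear_combination -e)) one_ne_zero
  have hz' : z' ≠ 0 := by
    rintro rfl
    exact hns (z / a) (by field_simp; linear_combination h1 - h2)
  refine hQ.reach_trans (rot (b' := y) (c' := z) (by linear_combination h - h1)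
    (fun e => ha (by linear_combination h - e))) ?_
  refine hQ.reach_trans (cyc _ _ _) (hQ.reach_trans (cyc _ _ _) ?_)
  refine hQ.reach_trans (rot (b' := z') (c' := 0) (by linear_combination h1 - h2) ?_) ?_
  · intro e
    exact hz' (by simpa using (by linear_combination h2 - h1 + e : z' ^ 2 = 0))
  refine hQ.reach_trans (cyc _ _ _) (zero_case _ _ (by linear_combination h2))

lemma eq_rotMat_of_commute {M : Matrix (Fin 2) (Fin 2) K} (h : M * quatI K = quatI K * M) :
    M = rotMat (M 0 0) (M 1 0) := by
  have h00 := congrFun (congrFun h 0) 0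
  have h01 := congrFun (congrFun h 0) 1
  simp [quatI, Matrix.mul_apply, Fin.sum_univ_two] at h00 h01
  ext i j
  fin_cases i <;> fin_cases j <;> simp [rotMat] <;> grind

lemma of_not_isSquare [Finite K] (hK : Odd (Nat.card K)) (hQ : RotClosed u v Q)
    (huv : u ^ 2 + v ^ 2 = -1) (hns : ∀ t : K, t ^ 2 ≠ -1)
    {M : Matrix (Fin 2) (Fin 2) K} (hM : M.det ≠ 0) : Q M := by
  have hI : pureQuat u v 1 0 0 = quatI K := by
    ext i j
    fin_cases i <;> fin_cases j <;> simp [pureQuat, quatI]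
  have h2 : (2 : K) ≠ 0 := fun h => hns 1 (by linear_combination h)
  obtain ⟨a, b, c, hV, hn⟩ : ∃ a b c, M * quatI K = pureQuat u v a b c * M ∧
      a ^ 2 + b ^ 2 + c ^ 2 = 1 := by
    set V := M.det⁻¹ • (M * quatI K * M.adjugate) with hV
    have hVM : V * M = M * quatI K := by
      rw [hV, smul_mul_assoc, Matrix.mul_assoc, adjugate_mul, mul_smul_comm, smul_smul,
        inv_mul_cancel₀ hM, one_smul, Matrix.mul_one]
    have htr : V 0 0 + V 1 1 = 0 := by
      have : V.trace = 0 := by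
        rw [hV, trace_smul, Matrix.mul_assoc, trace_mul_comm, Matrix.mul_assoc, adjugate_mul]
        simp [quatI, trace_fin_two]
      simpa [trace_fin_two] using this
    have hdet : V 0 0 * V 1 1 - V 0 1 * V 1 0 = 1 := by
      have : V.det * M.det = M.det := by
        rw [← det_mul, hVM, det_mul]; simp [quatI, det_fin_two]
      rw [← det_fin_two]
      exact mul_right_cancel₀ hM (by rw [this, one_mul])
    refine ⟨(V 1 0 - V 0 1) / 2, -(u * V 0 0 + v * (V 0 1 + V 1 0) / 2),
      v * V 0 0 - u * (V 0 1 + V 1 0) / 2, ?_, ?_⟩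
    · rw [← hVM]
      congr 1
      ext i j
      fin_cases i <;> fin_cases j <;> simp [pureQuat] <;> field_simp <;> grind
    · field_simp
      grind
  obtain ⟨g, hg, e⟩ := hQ.reach_of_norm_one hK huv hns hn
  refine hQ.of_mul_left hg ?_
  have hcomm : g * M * quatI K = quatI K * (g * M) := by
    rw [Matrix.mul_assoc, hV, ← Matrix.mul_assoc, e, hI, Matrix.mul_assoc]
  have hd : (g * M).det ≠ 0 := by
    rw [det_mul]; exact mul_ne_zero (hQ.det_ne hg) hM
  rw [eq_rotMat_of_commute hcomm] at hd ⊢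
  refine hQ.rot fun h => hd ?_
  rw [rotMat, det_fin_two_of]
  linear_combination h

lemma diag {t : K} (hQ : RotClosed t 0 Q) (h2 : (2 : K) ≠ 0) (ht : t ^ 2 = -1) {a d : K}
    (ha : a ≠ 0) (hd : d ≠ 0) : Q !![a, 0; 0, d] := by
  have ht0 : t ≠ 0 := by rintro rfl; simp at ht
  have hr : ((a + d) / 2) ^ 2 + ((a - d) / (2 * t)) ^ 2 ≠ 0 := by
    have : ((a + d) / 2) ^ 2 + ((a - d) / (2 * t)) ^ 2 = a * d := by
      field_simp; grind
    rw [this]; exact mul_ne_zero ha hd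
  have := hQ.smul (inv_ne_zero (mul_ne_zero h2 h2))
    (hQ.mul hQ.quatY (hQ.mul (hQ.rot hr) (hQ.adj hQ.quatY)))
  convert this using 1
  ext i j
  fin_cases i <;> fin_cases j <;>
    simp [_root_.quatY, rotMat, adjugate_fin_two] <;>
    field_simp <;> grind

lemma of_isSquare [Finite K] (hK : 5 < Nat.card K) (h2 : (2 : K) ≠ 0) {t : K}
    (hQ : RotClosed t 0 Q) (ht : t ^ 2 = -1)
    {M : Matrix (Fin 2) (Fin 2) K} (hM : M.det ≠ 0) : Q M := by
  classical
  have := Fintype.ofFinite K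
  rw [Nat.card_eq_fintype_card] at hK
  obtain ⟨n, hn⟩ : ∃ n : K, n ∉ ({0, 1, -1, t, -t} : Finset K) := by
    by_contra! h
    have : Fintype.card K ≤ 5 := by
      rw [← Finset.card_univ, ← Finset.eq_univ_of_forall h]
      exact Finset.card_le_five
    omega
  simp only [Finset.mem_insert, Finset.mem_singleton, not_or] at hn
  obtain ⟨hn0, hn1, hn2, hn3, hn4⟩ := hn
  have hm : n ^ 2 - 1 ≠ 0 := by
    have : n ^ 2 - 1 = (n - 1) * (n - -1) := by ring
    rw [this]; exact mul_ne_zero (sub_ne_zero.mpr hn1) (sub_ne_zero.mpr hn2)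
  have hp : n ^ 2 + 1 ≠ 0 := by
    have : n ^ 2 + 1 = (n - t) * (n - -t) := by linear_combination ht
    rw [this]; exact mul_ne_zero (sub_ne_zero.mpr hn3) (sub_ne_zero.mpr hn4)
  have diag := fun {a d : K} => hQ.diag h2 ht (a := a) (d := d)
  have hunip : ∀ b : K, Q !![1, b; 0, 1] := by
    intro b
    by_cases hb : b = 0
    · subst hb; exact diag one_ne_zero one_ne_zero
    have e1 := hQ.mul (hQ.rot (a := 1) (b := -1) (by norm_num [h2]))
      (hQ.mul (diag (a := 1) (d := -1 / n) one_ne_zero (by simp [hn0]))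
        (hQ.rot (a := 1) (b := -n) (by intro h; exact hp (by linear_combination h))))
    have e2 := hQ.mul (diag (a := 1 / 2) (d := (n ^ 2 - 1) / (-2 * b * (n ^ 2 + 1)))
      (by simp [h2]) (by simp [hb, hm, hp, h2])) e1
    have e3 := hQ.mul e2 (diag (a := 1) (d := 2 * b * n / (n ^ 2 - 1)) one_ne_zero
      (by simp [h2, hb, hn0, hm]))
    convert e3 using 1
    ext i j
    fin_cases i <;> fin_cases j <;>
      simp [rotMat, Matrix.mul_apply, Fin.sum_univ_two] <;> field_simp <;> grind
  have hI : Q (rotMat 0 1) := hQ.rot (by simp)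
  have main : ∀ N : Matrix (Fin 2) (Fin 2) K, N.det ≠ 0 → N 0 0 ≠ 0 → Q N := by
    intro N hN h0
    rw [det_fin_two] at hN
    have e1 := hQ.mul (hQ.mul hI (hunip (-N 1 0 / N 0 0))) (hQ.adj hI)
    have e2 := hQ.mul e1 (hQ.mul (diag h0 (div_ne_zero hN h0)) (hunip (N 0 1 / N 0 0)))
    convert e2 using 1
    ext i j
    fin_cases i <;> fin_cases j <;>
      simp [rotMat, adjugate_fin_two, Matrix.mul_apply, Fin.sum_univ_two] <;> field_simp <;> grind
  by_cases h0 : M 0 0 = 0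
  · refine hQ.of_mul_left hI (main _ ?_ ?_)
    · rw [det_mul]; exact mul_ne_zero (hQ.det_ne hI) hM
    · intro h
      simp [rotMat, Matrix.mul_apply, Fin.sum_univ_two] at h
      rw [det_fin_two] at hM
      simp [h0, h] at hM
  · exact main M hM h0

end RotClosed

end Generation

section Projective

variable {F : Type*} [Field F]

/-- The class in `PGL₂(F)` of an invertible matrix. -/
noncomputable def pmk (M : Matrix (Fin 2) (Fin 2) F) (h : M.det ≠ 0) : PGL2 F :=
  QuotientGroup.mk (GeneralLinearGroup.mkOfDetNeZero M h)

lemma pmk_surjective (g : PGL2 F) : ∃ M h, g = pmk M h := by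
  obtain ⟨m, rfl⟩ := QuotientGroup.mk_surjective g
  refine ⟨m.val, ((Matrix.isUnit_iff_isUnit_det _).mp m.isUnit).ne_zero, ?_⟩
  exact congrArg _ (Units.ext rfl)

lemma pmk_congr {M N : Matrix (Fin 2) (Fin 2) F} (h : M.det ≠ 0) (e : M = N) :
    pmk M h = pmk N (e ▸ h) := by subst e; rfl

lemma pmk_mul {M N : Matrix (Fin 2) (Fin 2) F} (h : M.det ≠ 0) (h' : N.det ≠ 0) :
    pmk M h * pmk N h' = pmk (M * N) (by rw [det_mul]; exact mul_ne_zero h h') := by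
  rw [pmk, pmk, pmk, ← QuotientGroup.mk_mul]
  exact congrArg _ (Units.ext rfl)

lemma pmk_one : pmk (1 : Matrix (Fin 2) (Fin 2) F) (by simp) = 1 :=
  congrArg QuotientGroup.mk (Units.ext rfl)

lemma pmk_pow {M : Matrix (Fin 2) (Fin 2) F} (h : M.det ≠ 0) (n : ℕ) :
    pmk M h ^ n = pmk (M ^ n) (by rw [det_pow]; exact pow_ne_zero _ h) := by
  induction n with
  | zero => simp only [pow_zero]; exact pmk_one.symm
  | succ n ih => simp only [pow_succ, ih, pmk_mul]

lemma pmk_eq_iff {M N : Matrix (Fin 2) (Fin 2) F} (h : M.det ≠ 0) (h' : N.det ≠ 0) :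
    pmk M h = pmk N h' ↔ ∃ c : F, c ≠ 0 ∧ N = c • M := by
  rw [pmk, pmk, QuotientGroup.eq, GeneralLinearGroup.mem_center_iff_val_mem_range_scalar]
  constructor
  · rintro ⟨c, hc⟩
    have e : N = M * scalar (Fin 2) c := by
      rw [hc]
      have := congrArg Units.val (mul_inv_cancel_left (GeneralLinearGroup.mkOfDetNeZero M h)
        (GeneralLinearGroup.mkOfDetNeZero N h'))
      simpa only [Units.val_mul] using! this.symm
    have e' : N = c • M := by
      rw [e, scalar_apply, smul_eq_mul_diagonal]
    refine ⟨c, ?_, e'⟩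
    rintro rfl
    simp [e'] at h'
  · rintro ⟨c, hc, rfl⟩
    refine ⟨c, ?_⟩
    have : GeneralLinearGroup.mkOfDetNeZero (c • M) h' = GeneralLinearGroup.mkOfDetNeZero M h *
        GeneralLinearGroup.scalar (Fin 2) (Units.mk0 c hc) := by
      apply Units.ext
      rw [Units.val_mul, GeneralLinearGroup.coe_scalar, Units.val_mk0, scalar_apply]
      exact smul_eq_mul_diagonal M c
    rw [this, inv_mul_cancel_left]
    rfl

lemma pmk_eq_one_iff {M : Matrix (Fin 2) (Fin 2) F} (h : M.det ≠ 0) :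
    pmk M h = 1 ↔ ∃ c : F, M = c • 1 := by
  rw [← pmk_one, eq_comm, pmk_eq_iff]
  refine ⟨fun ⟨c, _, e⟩ => ⟨c, e⟩, fun ⟨c, e⟩ => ⟨c, ?_, e⟩⟩
  rintro rfl
  simp [e] at h

lemma pmk_inv {M : Matrix (Fin 2) (Fin 2) F} (h : M.det ≠ 0) :
    (pmk M h)⁻¹ = pmk M.adjugate (by simpa [det_adjugate] using h) := by
  rw [inv_eq_iff_mul_eq_one, pmk_mul, pmk_eq_one_iff]
  exact ⟨_, mul_adjugate M⟩

/-- The map `PGL₂(K) → PGL₂(F)` induced by a field embedding. -/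
def pglMap {K : Type*} [Field K] (f : K →+* F) : PGL2 K →* PGL2 F :=
  QuotientGroup.map _ _ (GeneralLinearGroup.map f) (GeneralLinearGroup.map_center_le f)

lemma pglMap_pmk {K : Type*} [Field K] (f : K →+* F) {M : Matrix (Fin 2) (Fin 2) K}
    (h : M.det ≠ 0) :
    pglMap f (pmk M h) = pmk (M.map f) (by
      rw [← RingHom.mapMatrix_apply, ← RingHom.map_det]; simpa using h) := by
  rw [pmk, pglMap, QuotientGroup.map_mk]
  exact congrArg QuotientGroup.mk (Units.ext rfl)

lemma pglMap_injective {K : Type*} [Field K] (f : K →+* F) : Function.Injective (pglMap f) := by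
  rw [injective_iff_map_eq_one]
  intro g hg
  obtain ⟨M, h, rfl⟩ := pmk_surjective g
  rw [pglMap_pmk, pmk_eq_one_iff] at hg
  obtain ⟨c, hc⟩ := hg
  rw [pmk_eq_one_iff]
  have e := fun i j => congrFun (congrFun hc i) j
  have e00 := e 0 0
  have e01 := e 0 1
  have e10 := e 1 0
  have e11 := e 1 1
  simp at e00 e01 e10 e11
  refine ⟨M 0 0, ?_⟩
  have : M 1 1 = M 0 0 := f.injective (e11.trans e00.symm)
  ext i j
  fin_cases i <;> fin_cases j <;> simp [*]

/-- Generation of `PGL₂(K)` by the image of the torus of `quatI` and `quatY`. -/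
lemma closure_eq_top_of_rotMat_mem {K : Type*} [Field K] [Finite K] (hK : Odd (Nat.card K))
    (h2 : (2 : K) ≠ 0) {u v : K} (huv : u ^ 2 + v ^ 2 = -1)
    (hcase : (∀ t : K, t ^ 2 ≠ -1) ∨ v = 0 ∧ 5 < Nat.card K)
    (hY : (quatY u v).det ≠ 0) (H : Subgroup (PGL2 K)) (hYH : pmk (quatY u v) hY ∈ H)
    (hrot : ∀ (a b : K) (h : (rotMat a b).det ≠ 0), pmk (rotMat a b) h ∈ H) : H = ⊤ := by
  have hQ : RotClosed u v fun M => ∃ h, pmk M h ∈ H := by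
    refine ⟨fun ⟨h, _⟩ => h, fun ⟨h, m⟩ ⟨h', m'⟩ => ⟨_, pmk_mul h h' ▸ H.mul_mem m m'⟩,
      fun ⟨h, m⟩ => ⟨_, pmk_inv h ▸ H.inv_mem m⟩, ?_, ?_, hY, hYH⟩
    · rintro M c hc ⟨h, m⟩
      have h' : (c • M).det ≠ 0 := by simp [hc, h]
      exact ⟨h', (pmk_eq_iff h h').mpr ⟨c, hc, rfl⟩ ▸ m⟩
    · intro a b hab
      have h : (rotMat a b).det ≠ 0 := by
        rw [rotMat, det_fin_two_of]
        intro h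
        exact hab (by linear_combination h)
      exact ⟨h, hrot a b h⟩
  rw [eq_top_iff]
  intro g _
  obtain ⟨M, h, rfl⟩ := pmk_surjective g
  rcases hcase with hns | ⟨rfl, h5⟩
  · exact (hQ.of_not_isSquare hK huv hns h).2
  · refine (hQ.of_isSquare h5 h2 (by simpa using huv) h).2

lemma det_quatI : (quatI F).det ≠ 0 := by simp [quatI, det_fin_two]

lemma quatI_mul_self : quatI F * quatI F = -1 := by
  ext i j
  fin_cases i <;> fin_cases j <;> simp [quatI]

lemma det_quatY (h2 : (2 : F) ≠ 0) {u v : F} (huv : u ^ 2 + v ^ 2 = -1) :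
    (quatY u v).det ≠ 0 := by
  have : (quatY u v).det = 2 * 2 := by
    rw [quatY, det_fin_two_of]
    linear_combination -2 * huv
  rw [this]
  exact mul_ne_zero h2 h2

lemma trace_eq_zero_of_mul_self {M : Matrix (Fin 2) (Fin 2) F} {c : F} (h : M * M = c • 1)
    (hM : ∀ d : F, M ≠ d • 1) : M 1 1 = -M 0 0 := by
  have e := fun i j => congrFun (congrFun h i) j
  have e00 := e 0 0
  have e01 := e 0 1
  have e10 := e 1 0
  have e11 := e 1 1
  simp [Matrix.mul_apply, Fin.sum_univ_two] at e00 e01 e10 e11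
  by_contra hne
  have hs : M 0 0 + M 1 1 ≠ 0 := fun h => hne (by linear_combination h)
  have h01 : M 0 1 = 0 := mul_left_cancel₀ hs (by linear_combination e01)
  have h10 : M 1 0 = 0 := mul_left_cancel₀ hs (by linear_combination e10)
  have h11 : M 1 1 = M 0 0 := mul_left_cancel₀ hs (by rw [h01] at *; linear_combination e11 - e00)
  refine hM (M 0 0) ?_
  ext i j
  fin_cases i <;> fin_cases j <;> simp [*]

/-- Two anticommuting square roots of `-1` can be conjugated to `quatI` and `quatJ`. -/
lemma exists_conj_quat (h2 : (2 : F) ≠ 0) {u v : F} (huv : u ^ 2 + v ^ 2 = -1)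
    {A B : Matrix (Fin 2) (Fin 2) F} (hA : A * A = -1) (hB : B * B = -1) (hAB : A * B = -(B * A))
    (htA : A 1 1 = -A 0 0) (htB : B 1 1 = -B 0 0) :
    ∃ P : Matrix (Fin 2) (Fin 2) F, P.det ≠ 0 ∧ P * A = quatI F * P ∧ P * B = quatJ u v * P := by
  have eA := congrFun (congrFun hA 0) 0
  have eB := congrFun (congrFun hB 0) 0
  have eAB := congrFun (congrFun hAB 0) 0
  simp [Matrix.mul_apply, Fin.sum_univ_two] at eA eB eAB
  obtain ⟨w, hw, hwM⟩ := (exists_vecMul_eq_zero_iff (M := B + v • A - u • 1)).mpr (by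
    simp only [det_fin_two, Matrix.sub_apply, Matrix.add_apply, Matrix.smul_apply, smul_eq_mul,
      one_apply_eq, htA, htB, ne_eq, zero_ne_one, one_ne_zero, not_false_eq_true, one_apply_ne]
    linear_combination -eB - v ^ 2 * eA - v * eAB + huv)
  have w0 := congrFun hwM 0
  have w1 := congrFun hwM 1
  simp [vecMul, dotProduct, Fin.sum_univ_two, htA, htB] at w0 w1
  refine ⟨!![w 0, w 1; -(w 0 * A 0 0 + w 1 * A 1 0), -(w 0 * A 0 1 - w 1 * A 0 0)], ?_, ?_, ?_⟩
  · intro hdet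
    rw [det_fin_two_of] at hdet
    obtain ⟨l, l0, l1⟩ : ∃ l, w 0 * A 0 0 + w 1 * A 1 0 = l * w 0 ∧
        w 0 * A 0 1 - w 1 * A 0 0 = l * w 1 := by
      by_cases hw0 : w 0 = 0
      · have hw1 : w 1 ≠ 0 := fun h => hw (by ext i; fin_cases i <;> assumption)
        refine ⟨(w 0 * A 0 1 - w 1 * A 0 0) / w 1, ?_, ?_⟩ <;> field_simp
        linear_combination hdet
      · refine ⟨(w 0 * A 0 0 + w 1 * A 1 0) / w 0, ?_, ?_⟩ <;> field_simp
        linear_combination -hdet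
    have key : ∀ i, w i = 0 := by
      have n0 : w 0 * B 0 0 + w 1 * B 1 0 = (u - v * l) * w 0 := by linear_combination w0 - v * l0
      have n1 : w 0 * B 0 1 - w 1 * B 0 0 = (u - v * l) * w 1 := by linear_combination w1 - v * l1
      generalize u - v * l = n at n0 n1
      have hl : ∀ i, (l ^ 2 + 1) * w i = 0 := by
        intro i; fin_cases i <;> simp <;> grind
      have hn : ∀ i, (n ^ 2 + 1) * w i = 0 := by
        intro i; fin_cases i <;> simp <;> grind
      have hln : ∀ i, (2 * (l * n)) * w i = 0 := by
        intro i; fin_cases i <;> simp <;> grind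
      intro i
      by_contra hi
      have a1 := (mul_eq_zero.mp (hl i)).resolve_right hi
      have a2 := (mul_eq_zero.mp (hn i)).resolve_right hi
      have a3 := (mul_eq_zero.mp ((mul_eq_zero.mp (hln i)).resolve_right hi)).resolve_left h2
      rcases mul_eq_zero.mp a3 with rfl | rfl <;> simp at a1 a2
    exact hw (funext key)
  · ext i j
    fin_cases i <;> fin_cases j <;>
      simp [quatI, Matrix.mul_apply, Fin.sum_univ_two, htA] <;> grind
  · ext i j
    fin_cases i <;> fin_cases j <;>
      simp [quatJ, Matrix.mul_apply, Fin.sum_univ_two, htB] <;> grind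

lemma eq_smul_quatY (h2 : (2 : F) ≠ 0) {u v : F} (huv : u ^ 2 + v ^ 2 = -1)
    {X : Matrix (Fin 2) (Fin 2) F} (hI : X * quatI F = quatJ u v * X)
    (hJ : X * quatJ u v = quatI F * quatJ u v * X) : ∃ c : F, X = c • quatY u v := by
  have e := fun i j => congrFun (congrFun hI i) j
  have e00 := e 0 0
  have e10 := e 1 0
  have e' := fun i j => congrFun (congrFun hJ i) j
  have f00 := e' 0 0
  have f01 := e' 0 1
  have f10 := e' 1 0
  have f11 := e' 1 1
  simp [quatI, quatJ, Matrix.mul_apply, Fin.sum_univ_two] at e00 e10 f00 f01 f10 f11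
  refine ⟨(X 0 0 * (1 - u + v) - X 0 1 * (1 + v + u)) / (2 * 2), ?_⟩
  ext i j
  fin_cases i <;> fin_cases j <;> simp [quatY] <;> field_simp <;> grind

lemma conj_of_intertwine {P A B : Matrix (Fin 2) (Fin 2) F} (hP : P.det ≠ 0)
    (h : P * A = B * P) : A * P.adjugate = P.adjugate * B := by
  have : P.det • (A * P.adjugate) = P.det • (P.adjugate * B) := by
    calc _ = P.adjugate * (P * A) * P.adjugate := by
          rw [← Matrix.mul_assoc, adjugate_mul, smul_mul_assoc, Matrix.one_mul, smul_mul_assoc]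
      _ = _ := by
          rw [h, Matrix.mul_assoc, Matrix.mul_assoc, mul_adjugate, mul_smul_comm, Matrix.mul_one,
            mul_smul_comm]
  exact smul_right_injective _ hP this

/-- An involution `i` and an element `x` cyclically permuting `i`, `j`, `i * j` can be
simultaneously conjugated to the classes of `quatI` and `quatY`. -/
lemma exists_conj_quatY (h2 : (2 : F) ≠ 0) {u v : F} (huv : u ^ 2 + v ^ 2 = -1)
    {i j x : PGL2 F} (hi : orderOf i = 2) (hxi : x⁻¹ * i * x = i * j) (hxj : x⁻¹ * j * x = i) :
    ∃ P : PGL2 F, P * i * P⁻¹ = pmk (quatI F) det_quatI ∧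
      P * x * P⁻¹ = pmk (quatY u v) (det_quatY h2 huv) := by
  have hii : i * i = 1 := by
    rw [← pow_two]; exact orderOf_dvd_iff_pow_eq_one.mp (dvd_of_eq hi)
  have hj : j = x * i * x⁻¹ := by rw [← hxj]; group
  have hij : x * j * x⁻¹ = i * j := by
    have hjj : j * j = 1 := by rw [hj]; calc
      _ = x * (i * i) * x⁻¹ := by group
      _ = 1 := by rw [hii]; group
    have hc : (i * j) * (i * j) = 1 := by rw [← hxi]; calc
      _ = x⁻¹ * (i * i) * x := by group
      _ = 1 := by rw [hii]; group
    have hcomm : i * j = j * i := by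
      calc _ = i * (i * j * (i * j)) * j := by rw [hc, mul_one]
        _ = (i * i) * j * i * (j * j) := by group
        _ = _ := by rw [hii, hjj, one_mul, mul_one]
    have hi' : i = x * (i * j) * x⁻¹ := by rw [← hxi]; group
    calc x * j * x⁻¹ = (x * i * x⁻¹)⁻¹ * (x * (i * j) * x⁻¹) := by group
      _ = j⁻¹ * i := by rw [← hj, ← hi']
      _ = i * j := by rw [hcomm, inv_eq_of_mul_eq_one_left hjj]
  obtain ⟨A₀, hA₀, rfl⟩ := pmk_surjective i
  obtain ⟨X, hX, rfl⟩ := pmk_surjective x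
  have hA₀n : ∀ c : F, A₀ ≠ c • 1 := by
    intro c hc
    rw [(pmk_eq_one_iff hA₀).mpr ⟨c, hc⟩, orderOf_one] at hi
    exact absurd hi (by norm_num)
  have conjX : ∀ (N : Matrix (Fin 2) (Fin 2) F) (hN : N.det ≠ 0), ∃ (N' : _) (h : N'.det ≠ 0),
      N' * X = X * N ∧ pmk X hX * pmk N hN * (pmk X hX)⁻¹ = pmk N' h := by
    intro N hN
    have e : X.det⁻¹ • (X * N * X.adjugate) * X = X * N := by
      rw [smul_mul_assoc, Matrix.mul_assoc, adjugate_mul, mul_smul_comm, smul_smul,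
        inv_mul_cancel₀ hX, one_smul, Matrix.mul_one]
    have hd : (X.det⁻¹ • (X * N * X.adjugate)).det ≠ 0 := by
      intro h
      have := congrArg det e
      rw [det_mul, det_mul, h, zero_mul] at this
      exact mul_ne_zero hX hN this.symm
    refine ⟨_, hd, e, ?_⟩
    rw [mul_inv_eq_iff_eq_mul, pmk_mul, pmk_mul]
    exact pmk_congr _ e.symm
  obtain ⟨B₀, hB₀, hBX, hB⟩ := conjX A₀ hA₀
  obtain ⟨C₀, hC₀, hCX, hC⟩ := conjX B₀ hB₀
  rw [hB] at hj
  rw [hj, hC, pmk_mul, eq_comm, pmk_eq_iff] at hij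
  obtain ⟨c, hc, rfl⟩ := hij
  rw [pmk_mul, pmk_eq_one_iff] at hii
  obtain ⟨e, he⟩ := hii
  set A := c • A₀ with hAdef
  set B := c • B₀ with hBdef
  have hBX : B * X = X * A := by rw [hAdef, hBdef, smul_mul_assoc, hBX, mul_smul_comm]
  have hABX : A * B * X = X * B := by
    rw [hAdef, hBdef, mul_smul_comm c X, ← hCX]
    simp only [smul_mul_assoc, mul_smul_comm]
  have hdetB : B.det = A.det := by
    have := congrArg det hBX
    rw [det_mul, det_mul, mul_comm] at this
    exact mul_left_cancel₀ hX this
  have hdetA : A.det = 1 := by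
    have := congrArg det hABX
    rw [det_mul, det_mul, det_mul, mul_comm] at this
    have := mul_left_cancel₀ hX this
    have hB' : B.det ≠ 0 := by simp [hBdef, hc, hB₀]
    exact mul_right_cancel₀ hB' (by rw [this, one_mul])
  have htr : ∀ {M N : Matrix (Fin 2) (Fin 2) F}, N * X = X * M → N.trace = M.trace := by
    intro M N h
    have : X.det • N = X * M * X.adjugate := by
      rw [← h, Matrix.mul_assoc, mul_adjugate, mul_smul_comm, Matrix.mul_one]
    have := congrArg trace this
    rw [trace_smul, Matrix.mul_assoc, trace_mul_comm, Matrix.mul_assoc, adjugate_mul,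
      mul_smul_comm, Matrix.mul_one, trace_smul] at this
    exact mul_left_cancel₀ hX this
  have htA : A 1 1 = -A 0 0 := by
    have := trace_eq_zero_of_mul_self he hA₀n
    simp [hAdef, this]
  have htB : B 1 1 = -B 0 0 := by
    have := htr hBX
    rw [trace_fin_two, trace_fin_two, htA] at this
    linear_combination this
  have htAB : (A * B) 0 0 + (A * B) 1 1 = 0 := by
    have := htr hABX
    rw [trace_fin_two, trace_fin_two, htB] at this
    linear_combination this
  have sq : ∀ {M : Matrix (Fin 2) (Fin 2) F}, M 1 1 = -M 0 0 → M.det = 1 → M * M = -1 := by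
    intro M h h'
    rw [det_fin_two, h] at h'
    ext i j
    fin_cases i <;> fin_cases j <;> simp [Matrix.mul_apply, Fin.sum_univ_two, h] <;> grind
  have hanti : A * B = -(B * A) := by
    simp only [Matrix.mul_apply, Fin.sum_univ_two, htA, htB] at htAB
    ext i j
    fin_cases i <;> fin_cases j <;>
      simp [Matrix.mul_apply, Fin.sum_univ_two, htA, htB] <;> grind
  obtain ⟨P, hP, hPA, hPB⟩ := exists_conj_quat h2 huv (sq htA hdetA) (sq htB (hdetB.trans hdetA))
    hanti htA htB
  have hX' : (P * X * P.adjugate).det ≠ 0 := by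
    rw [det_mul, det_mul]
    exact mul_ne_zero (mul_ne_zero hP hX) (by simpa [det_adjugate] using hP)
  have hPA' := conj_of_intertwine hP hPA
  have hPB' := conj_of_intertwine hP hPB
  obtain ⟨d, hd⟩ := eq_smul_quatY h2 huv (X := P * X * P.adjugate)
    (by rw [Matrix.mul_assoc, ← hPA', ← Matrix.mul_assoc, Matrix.mul_assoc P, ← hBX,
          ← Matrix.mul_assoc, hPB]; simp only [Matrix.mul_assoc])
    (by rw [Matrix.mul_assoc, ← hPB', ← Matrix.mul_assoc, Matrix.mul_assoc P, ← hABX,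
          ← Matrix.mul_assoc, ← Matrix.mul_assoc, hPA, Matrix.mul_assoc (quatI F), hPB]
        simp only [Matrix.mul_assoc])
  refine ⟨pmk P hP, ?_, ?_⟩
  · rw [mul_inv_eq_iff_eq_mul, pmk_mul, pmk_mul, pmk_eq_iff]
    exact ⟨c, hc, by rw [← hPA, hAdef, mul_smul_comm]⟩
  · rw [pmk_inv, pmk_mul, pmk_mul, eq_comm, pmk_eq_iff]
    refine ⟨d, ?_, hd⟩
    rintro rfl
    simp [hd] at hX'

/-- An element of order greater than two centralizing `quatI` is the class of some
`τ + quatI`. -/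
lemma exists_eq_pmk_rotMat {g : PGL2 F} (hg : g ^ 2 ≠ 1)
    (hc : g * pmk (quatI F) det_quatI = pmk (quatI F) det_quatI * g) :
    ∃ (t : F) (h : (rotMat t 1).det ≠ 0), g = pmk (rotMat t 1) h := by
  obtain ⟨R, hR, rfl⟩ := pmk_surjective g
  rw [pmk_mul, pmk_mul, eq_comm, pmk_eq_iff] at hc
  obtain ⟨c, hc0, hc⟩ := hc
  have hc2 : (c - 1) * (c + 1) = 0 := by
    have := congrArg det hc
    rw [det_mul, det_smul, det_mul, Fintype.card_fin] at this
    have h' : R.det * (quatI F).det ≠ 0 := mul_ne_zero hR det_quatI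
    have : c ^ 2 = 1 := mul_right_cancel₀ h' (by linear_combination -this)
    linear_combination this
  rcases mul_eq_zero.mp hc2 with h | h
  · obtain rfl : c = 1 := by linear_combination h
    rw [one_smul] at hc
    have hrot := RotClosed.eq_rotMat_of_commute hc
    have hb : R 1 0 ≠ 0 := by
      intro hb
      refine hg ?_
      rw [(pmk_eq_one_iff hR).mpr ⟨R 0 0, ?_⟩, one_pow]
      rw [hb] at hrot
      rw [hrot]
      ext i j
      fin_cases i <;> fin_cases j <;> simp [rotMat]
    have e : R = R 1 0 • rotMat (R 0 0 / R 1 0) 1 := by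
      conv_lhs => rw [hrot]
      ext i j
      fin_cases i <;> fin_cases j <;> simp [rotMat] <;> field_simp
    have hd : (rotMat (R 0 0 / R 1 0) 1).det ≠ 0 := by
      intro h
      rw [e, det_smul, h, mul_zero] at hR
      exact hR rfl
    exact ⟨_, hd, ((pmk_eq_iff hd hR).mpr ⟨_, hb, e⟩).symm⟩
  · obtain rfl : c = -1 := by linear_combination h
    refine absurd ?_ hg
    rw [neg_one_smul] at hc
    have h00 := congrFun (congrFun hc 0) 0
    have h01 := congrFun (congrFun hc 0) 1
    simp [quatI, Matrix.mul_apply, Fin.sum_univ_two, vecMul, dotProduct] at h00 h01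
    rw [pow_two, pmk_mul, pmk_eq_one_iff]
    refine ⟨R 0 0 ^ 2 + R 0 1 ^ 2, ?_⟩
    ext i j
    fin_cases i <;> fin_cases j <;> simp [Matrix.mul_apply, Fin.sum_univ_two] <;> grind

lemma rotMat_one_pow_char_pow {p : ℕ} [Fact p.Prime] [CharP F p] (a : ℕ) (t : F) :
    rotMat t 1 ^ p ^ a = t ^ p ^ a • (1 : Matrix (Fin 2) (Fin 2) F) + quatI F ^ p ^ a := by
  have e : rotMat t 1 = t • (1 : Matrix (Fin 2) (Fin 2) F) + quatI F := by
    ext i j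
    fin_cases i <;> fin_cases j <;> simp [rotMat, quatI]
  have : CharP (Matrix (Fin 2) (Fin 2) F) p := Matrix.charP p
  rw [e, add_pow_char_pow_of_commute _ _ ((Commute.one_left _).smul_left t), smul_pow, one_pow]

lemma quatI_pow_of_mod_four_eq_one {n : ℕ} (hn : n % 4 = 1) : quatI F ^ n = quatI F := by
  rw [← Nat.div_add_mod n 4, hn, pow_succ, pow_mul,
    show quatI F ^ 4 = (quatI F * quatI F) * (quatI F * quatI F) by noncomm_ring,
    quatI_mul_self]
  simp

lemma quatI_pow_of_mod_four_eq_three {n : ℕ} (hn : n % 4 = 3) : quatI F ^ n = -quatI F := by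
  rw [show n = n - 2 + 2 by omega, pow_add, quatI_pow_of_mod_four_eq_one (by omega), pow_two,
    quatI_mul_self]
  simp

/-- A class `τ + quatI` whose order divides `p ^ a - ε` has `τ` in the subfield with `p ^ a`
elements. -/
lemma pow_char_pow_eq_self {p : ℕ} [Fact p.Prime] [CharP F p] {a n : ℕ} {t : F}
    (h : (rotMat t 1).det ≠ 0) (hg : pmk (rotMat t 1) h ^ n = 1)
    (hn : p ^ a % 4 = 1 ∧ n + 1 = p ^ a ∨ p ^ a % 4 = 3 ∧ n = p ^ a + 1) :
    t ^ p ^ a = t := by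
  rw [pmk_pow, pmk_eq_one_iff] at hg
  obtain ⟨c, hc⟩ := hg
  have key := rotMat_one_pow_char_pow (p := p) a t
  rcases hn with ⟨h4, hn⟩ | ⟨h4, hn⟩
  · rw [quatI_pow_of_mod_four_eq_one h4, ← hn, pow_succ, hc, hn] at key
    have h00 := congrFun (congrFun key 0) 0
    have h10 := congrFun (congrFun key 1) 0
    simp [rotMat, quatI] at h00 h10
    rw [← h00, h10, one_mul]
  · rw [quatI_pow_of_mod_four_eq_three h4] at key
    rw [hn, pow_succ, key] at hc
    have h10 := congrFun (congrFun hc 1) 0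
    simp [rotMat, quatI, Matrix.mul_apply, Fin.sum_univ_two] at h10
    linear_combination h10

lemma exists_map_eq_of_pow_card_eq {K : Type*} [Field K] [Finite K] (f : K →+* F) {t : F}
    (ht : t ^ Nat.card K = t) : ∃ s, f s = t := by
  classical
  have := Fintype.ofFinite K
  rw [Nat.card_eq_fintype_card] at ht
  let P : Polynomial F := .X ^ Fintype.card K - .X
  have hP : P ≠ 0 := FiniteField.X_pow_card_sub_X_ne_zero F Fintype.one_lt_card
  have hdeg : P.natDegree = Fintype.card K :=
    FiniteField.X_pow_card_sub_X_natDegree_eq F Fintype.one_lt_card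
  have hmem (y : F) : y ∈ P.roots.toFinset ↔ y ^ Fintype.card K = y := by
    simp [hP, P, sub_eq_zero]
  have hsub : Finset.univ.image f ⊆ P.roots.toFinset := by
    intro y hy
    obtain ⟨s, -, rfl⟩ := Finset.mem_image.mp hy
    rw [hmem, ← map_pow, FiniteField.pow_card]
  have hle : P.roots.toFinset.card ≤ (Finset.univ.image f).card := by
    rw [Finset.card_image_of_injective _ f.injective, Finset.card_univ]
    exact (Multiset.toFinset_card_le _).trans (P.card_roots'.trans hdeg.le)
  have := (hmem t).mpr ht
  rw [← Finset.eq_of_subset_of_card_le hsub hle] at this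
  obtain ⟨s, -, hs⟩ := Finset.mem_image.mp this
  exact ⟨s, hs⟩

/-- An element `τ + quatI` of maximal order generates the whole torus. -/
lemma rotMat_mem_zpowers {K : Type*} [Field K] [Finite K] {t : K} (h : (rotMat t 1).det ≠ 0)
    (hn : {s : K | s ^ 2 ≠ -1}.ncard + 1 ≤ orderOf (pmk (rotMat t 1) h))
    (a b : K) (hab : (rotMat a b).det ≠ 0) :
    pmk (rotMat a b) hab ∈ Subgroup.zpowers (pmk (rotMat t 1) h) := by
  classical
  set g := pmk (rotMat t 1) h with hg
  let S : Set (PGL2 K) := {g | ∃ (a b : K) (h : (rotMat a b).det ≠ 0), g = pmk (rotMat a b) h}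
  have hpow (n : ℕ) : g ^ n ∈ S := by
    induction n with
    | zero =>
      have e : rotMat 1 0 = (1 : Matrix (Fin 2) (Fin 2) K) := by
        ext i j
        fin_cases i <;> fin_cases j <;> simp [rotMat]
      exact ⟨1, 0, by simp [e], by rw [pow_zero, pmk_congr _ e, pmk_one]⟩
    | succ n ih =>
      obtain ⟨c, d, hcd, e⟩ := ih
      have e' : rotMat c d * rotMat t 1 = rotMat (c * t - d) (c + d * t) := by
        ext i j
        fin_cases i <;> fin_cases j <;>
          simp [rotMat, Matrix.mul_apply, Fin.sum_univ_two] <;> ring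
      rw [pow_succ, e, hg, pmk_mul, pmk_congr _ e']
      exact ⟨_, _, _, rfl⟩
  have hsub : (Subgroup.zpowers g : Set (PGL2 K)) ⊆ S := by
    intro y hy
    obtain ⟨n, rfl⟩ := mem_powers_iff_mem_zpowers.mpr hy
    exact hpow n
  let F' : K → PGL2 K := fun s =>
    if hs : (rotMat s 1).det ≠ 0 then pmk (rotMat s 1) hs else 1
  have hS : S ⊆ insert 1 (F' '' {s : K | s ^ 2 ≠ -1}) := by
    rintro _ ⟨c, d, hcd, rfl⟩
    by_cases hd : d = 0
    · left
      rw [pmk_eq_one_iff]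
      refine ⟨c, ?_⟩
      ext i j
      fin_cases i <;> fin_cases j <;> simp [rotMat, hd]
    · right
      have e : rotMat c d = d • rotMat (c / d) 1 := by
        ext i j
        fin_cases i <;> fin_cases j <;> simp [rotMat] <;> field_simp
      have hdet : (rotMat (c / d) 1).det ≠ 0 := by
        intro h
        rw [e, det_smul, h, mul_zero] at hcd
        exact hcd rfl
      refine ⟨c / d, ?_, ?_⟩
      · intro hc
        refine hdet ?_
        simp [rotMat, det_fin_two]
        linear_combination hc
      · simp only [F', dif_pos hdet]
        exact (pmk_eq_iff _ _).mpr ⟨d, hd, e⟩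
  have hcard : S.ncard ≤ (Subgroup.zpowers g : Set (PGL2 K)).ncard := by
    calc S.ncard ≤ _ := Set.ncard_le_ncard hS
      _ ≤ _ := Set.ncard_insert_le _ _
      _ ≤ _ := Nat.add_le_add_right Set.ncard_image_le 1
      _ ≤ _ := hn
      _ = _ := by rw [← Nat.card_zpowers]; rfl
  have := Set.eq_of_subset_of_ncard_le hsub hcard
  rw [← SetLike.mem_coe, this]
  exact ⟨a, b, hab, rfl⟩

lemma ncard_sq_ne_neg_one_of_sq_eq {K : Type*} [Field K] [Finite K] (h2 : (2 : K) ≠ 0) {t : K}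
    (ht : t ^ 2 = -1) : {s : K | s ^ 2 ≠ -1}.ncard + 2 = Nat.card K := by
  have ht0 : t ≠ 0 := by rintro rfl; simp at ht
  have e : {s : K | s ^ 2 ≠ -1} = {t, -t}ᶜ := by
    ext s
    simp [← ht, sq_eq_sq_iff_eq_or_eq_neg]
  have htt : t ≠ -t := by
    intro h
    exact mul_ne_zero h2 ht0 (by linear_combination h)
  rw [e, ← Set.ncard_pair htt, add_comm, Set.ncard_add_ncard_compl]

lemma ncard_sq_ne_neg_one_le {K : Type*} [Field K] [Finite K] :
    {s : K | s ^ 2 ≠ -1}.ncard ≤ Nat.card K := by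
  rw [← Set.ncard_univ]
  exact Set.ncard_le_ncard (Set.subset_univ _)

/-- The closure statement over an abstract pair of finite fields `K ⊆ F`. -/
lemma nonempty_closure_mulEquiv {K : Type*} [Field K] [Finite K] {p a n : ℕ} [Fact p.Prime]
    [CharP F p] (hodd : Odd p) (hK : Nat.card K = p ^ a) (f : K →+* F) (hn2 : 2 < n)
    (hn : p ^ a % 4 = 1 ∧ n + 1 = p ^ a ∧ 5 < p ^ a ∨ p ^ a % 4 = 3 ∧ n = p ^ a + 1)
    {i j x r : PGL2 F} (hi : orderOf i = 2) (hxi : x⁻¹ * i * x = i * j)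
    (hxj : x⁻¹ * j * x = i) (hri : r * i = i * r) (hr : orderOf r = n) :
    Nonempty ((Subgroup.closure {r, x} : Subgroup (PGL2 F)) ≃* PGL2 K) := by
  have hoddK : Odd (Nat.card K) := hK ▸ hodd.pow
  have h2F : (2 : F) ≠ 0 := by
    refine Ring.two_ne_zero ?_
    rw [ringChar.eq F p]
    rintro rfl
    exact absurd hodd (by decide)
  have h2 : (2 : K) ≠ 0 := fun h => h2F (by rw [← map_ofNat f 2, h, map_zero])
  obtain ⟨u, v, huv, hcase, hcard⟩ : ∃ u v : K, u ^ 2 + v ^ 2 = -1 ∧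
      ((∀ t : K, t ^ 2 ≠ -1) ∨ v = 0 ∧ 5 < Nat.card K) ∧
        {s : K | s ^ 2 ≠ -1}.ncard + 1 ≤ n := by
    have := Fintype.ofFinite K
    have hsq := FiniteField.isSquare_neg_one_iff (F := K)
    rw [← Nat.card_eq_fintype_card, hK] at hsq
    rcases hn with ⟨h4, hn, h5⟩ | ⟨h4, hn⟩
    · obtain ⟨t, ht⟩ := hsq.mpr (by omega)
      have ht' : t ^ 2 = -1 := by rw [ht, pow_two]
      refine ⟨t, 0, by simp [ht'], Or.inr ⟨rfl, hK ▸ h5⟩, ?_⟩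
      have := ncard_sq_ne_neg_one_of_sq_eq h2 ht'
      omega
    · have hns : ∀ t : K, t ^ 2 ≠ -1 := fun t ht =>
        hsq.mp ⟨t, by rw [← ht, pow_two]⟩ h4
      have : CharP K p := f.charP f.injective p
      obtain ⟨u, v, huv⟩ := CharP.sq_add_sq K p (-1)
      refine ⟨u, v, by simpa using huv, Or.inl hns, ?_⟩
      have := ncard_sq_ne_neg_one_le (K := K)
      omega
  have huvF : f u ^ 2 + f v ^ 2 = -1 := by
    rw [← map_pow, ← map_pow, ← map_add, huv, map_neg, map_one]
  obtain ⟨P, hPi, hPx⟩ := exists_conj_quatY h2F huvF hi hxi hxj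
  have hr2 : (P * r * P⁻¹) ^ 2 ≠ 1 := by
    rw [conj_pow, ne_eq, conj_eq_one_iff]
    intro h
    have := orderOf_le_of_pow_eq_one two_pos h
    omega
  obtain ⟨t, ht, hPr⟩ := exists_eq_pmk_rotMat hr2 (by
    rw [← hPi]
    calc P * r * P⁻¹ * (P * i * P⁻¹) = P * (r * i) * P⁻¹ := by group
      _ = P * (i * r) * P⁻¹ := by rw [hri]
      _ = _ := by group)
  have htK : t ^ Nat.card K = t := by
    rw [hK]
    refine pow_char_pow_eq_self ht (n := n) ?_ (by tauto)
    rw [← hPr, conj_pow, conj_eq_one_iff, ← hr, pow_orderOf_eq_one]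
  obtain ⟨s, rfl⟩ := exists_map_eq_of_pow_card_eq f htK
  have hs : (rotMat s 1).det ≠ 0 := by
    intro h
    refine ht ?_
    simp only [rotMat, det_fin_two_of] at h ⊢
    simpa using congrArg f h
  have hY := det_quatY h2 huv
  have er : P * r * P⁻¹ = pglMap f (pmk (rotMat s 1) hs) := by
    rw [hPr, pglMap_pmk]
    refine pmk_congr _ ?_
    ext i j
    fin_cases i <;> fin_cases j <;> simp [rotMat]
  have ex : P * x * P⁻¹ = pglMap f (pmk (quatY u v) hY) := by
    rw [hPx, pglMap_pmk]
    refine pmk_congr _ ?_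
    ext i j
    fin_cases i <;> fin_cases j <;> simp [quatY]
  have hord : orderOf (pmk (rotMat s 1) hs) = n := by
    rw [← orderOf_injective _ (pglMap_injective f), ← er, ← hr]
    exact orderOf_injective (MulAut.conj P).toMonoidHom (MulAut.conj P).injective r
  have htop : Subgroup.closure {pmk (rotMat s 1) hs, pmk (quatY u v) hY} = ⊤ := by
    refine closure_eq_top_of_rotMat_mem hoddK h2 huv hcase hY _
      (Subgroup.subset_closure (by simp)) fun a b h => ?_
    refine Subgroup.zpowers_le.mpr (Subgroup.subset_closure (by simp))
      (rotMat_mem_zpowers hs ?_ a b h)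
    rwa [hord]
  let φ : PGL2 K →* PGL2 F := (MulAut.conj P⁻¹).toMonoidHom.comp (pglMap f)
  have hφ : Function.Injective φ := (MulAut.conj P⁻¹).injective.comp (pglMap_injective f)
  have hφr : φ (pmk (rotMat s 1) hs) = r := by
    change P⁻¹ * pglMap f _ * P⁻¹⁻¹ = r
    rw [← er]
    group
  have hφx : φ (pmk (quatY u v) hY) = x := by
    change P⁻¹ * pglMap f _ * P⁻¹⁻¹ = x
    rw [← ex]
    group
  have hrange : Subgroup.closure {r, x} = φ.range := by
    rw [MonoidHom.range_eq_map, ← htop, MonoidHom.map_closure, Set.image_pair, hφr, hφx]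
  exact ⟨(MulEquiv.subgroupCongr hrange).trans (MonoidHom.ofInjective hφ).symm⟩

end Projective

/-- Lemma 2.4 of the paper: in `G = PGL₂(𝔽_{p^k})`, `p` an odd prime, `k ≥ 2`,
given the data `(i, j, x, s, T)` producing `Sym₄` and an element `r ∈ T` of
order `p^a - ε_a` (with `a ∣ k` and `4 ∣ p^a - ε_a`), the subgroup `⟨r, x⟩` is
isomorphic to `PGL₂(𝔽_{p^a})`, unless `a = 1` and `p = 5`. -/
theorem subfield_subgroup_PGL2
    (p : ℕ) [Fact p.Prime] (hp : Odd p) (k : ℕ) (hk : 2 ≤ k)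
    (q : ℕ) (hq : q = p ^ k)
    (d : ℕ) (hd : (q % 4 = 1 ∧ d = q - 1) ∨ (q % 4 = 3 ∧ d = q + 1))
    (i : PGL2 (GaloisField p k)) (hi : orderOf i = 2)
    (T : Subgroup (PGL2 (GaloisField p k)))
    (hTle : T ≤ Subgroup.centralizer {i}) (hTcyc : IsCyclic T)
    (hTcard : Nat.card T = d)
    (j : PGL2 (GaloisField p k)) (hj : orderOf j = 2)
    (hjinv : ∀ t ∈ T, j⁻¹ * t * j = t⁻¹)
    (hjcent : Nat.card (Subgroup.centralizer {j} : Subgroup (PGL2 (GaloisField p k)))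
      = 2 * d)
    (x : PGL2 (GaloisField p k)) (hx : orderOf x = 3)
    (hxi : x⁻¹ * i * x = i * j) (hxj : x⁻¹ * j * x = i)
    (s : PGL2 (GaloisField p k)) (hsT : s ∈ T) (hs : orderOf s = 4)
    (a : ℕ) (ha : 0 < a) (hak : a ∣ k)
    (da : ℕ) (hda : (da = p ^ a - 1 ∨ da = p ^ a + 1) ∧ 4 ∣ da)
    (r : PGL2 (GaloisField p k)) (hrT : r ∈ T) (hr : orderOf r = da)
    (hexc : ¬ (a = 1 ∧ p = 5)) :
    Nonempty ((Subgroup.closure {r, x} : Subgroup (PGL2 (GaloisField p k)))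
      ≃* PGL2 (GaloisField p a)) := by
  have hprime : p.Prime := Fact.out
  have hp3 : 3 ≤ p := by
    have := hprime.two_le
    obtain ⟨m, hm⟩ := hp
    omega
  have hpa : p ≤ p ^ a := Nat.le_self_pow ha.ne' p
  have h5 : p ^ a ≠ 5 := by
    intro h
    have h5p : Nat.Prime (p ^ a) := h ▸ Nat.prime_five
    have ha1 := h5p.eq_one_of_pow
    exact hexc ⟨ha1, by simpa [ha1] using h⟩
  obtain ⟨f⟩ := FiniteField.nonempty_algHom_of_finrank_dvd (F := ZMod p)
    (K := GaloisField p a) (L := GaloisField p k)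
    (by rwa [GaloisField.finrank p ha.ne', GaloisField.finrank p (by omega)])
  refine nonempty_closure_mulEquiv hp (GaloisField.card p a ha.ne') f.toRingHom (n := da)
    ?_ ?_ hi hxi hxj (Subgroup.mem_centralizer_singleton_iff.mp (hTle hrT)) hr
  · omega
  · obtain ⟨hda, h4⟩ := hda
    omega
end

section
/- Let p be an odd prime and k ≥ 1. Every subgroup S of PGL₂(𝔽_{p^k}) that is isomorphic to the symmetric group on 4 letters is contained in a subgroup H of PGL₂(𝔽_{p^k}) that is isomorphic to PGL₂(𝔽_p). -/
open Matrix

namespace PGL2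

section Field

variable {F : Type*} [Field F]

theorem mk_eq_mk_iff {g h : GL (Fin 2) F} :
    (g : PGL2 F) = h ↔ ∃ c : F, c ≠ 0 ∧ h.val = c • g.val := by
  rw [QuotientGroup.eq, GeneralLinearGroup.center_eq_range_scalar]
  constructor
  · rintro ⟨u, hu⟩
    refine ⟨u, u.ne_zero, ?_⟩
    have h1 : h = g * GeneralLinearGroup.scalar (Fin 2) u := by rw [hu]; group
    rw [h1]
    ext i j
    simp [mul_comm]
  · rintro ⟨c, hc, h1⟩
    refine ⟨Units.mk0 c hc, ?_⟩
    rw [eq_inv_mul_iff_mul_eq]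
    ext i j
    simp [h1, mul_comm]

/-- A lift of an involution of `PGL₂(F)` has trace zero. -/
theorem trace_eq_zero_of_mk_sq_eq_one {g : GL (Fin 2) F} (h2 : (g : PGL2 F) * g = 1)
    (h1 : (g : PGL2 F) ≠ 1) : g.val.trace = 0 := by
  by_contra ht
  apply h1
  rw [← QuotientGroup.mk_one, ← QuotientGroup.mk_mul, eq_comm, mk_eq_mk_iff] at h2
  rw [← QuotientGroup.mk_one, eq_comm, mk_eq_mk_iff]
  obtain ⟨c, hc, h⟩ := h2
  have e (i j) := congrFun (congrFun h i) j
  have e00 := e 0 0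
  have e01 := e 0 1
  have e10 := e 1 0
  have e11 := e 1 1
  simp only [Units.val_mul, Matrix.mul_apply, Fin.sum_univ_two, Units.val_one, Matrix.smul_apply,
    Matrix.one_apply_eq, smul_eq_mul, mul_one, ne_eq, zero_ne_one, one_ne_zero, not_false_eq_true,
    Matrix.one_apply_ne, mul_zero] at e00 e01 e10 e11
  rw [Matrix.trace_fin_two] at ht
  have b0 : g.val 0 1 = 0 := by
    have : (g.val 0 0 + g.val 1 1) * g.val 0 1 = 0 := by linear_combination e01
    simpa [ht] using this
  have c0 : g.val 1 0 = 0 := by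
    have : (g.val 0 0 + g.val 1 1) * g.val 1 0 = 0 := by linear_combination e10
    simpa [ht] using this
  have d0 : g.val 1 1 = g.val 0 0 := by
    have : (g.val 0 0 + g.val 1 1) * (g.val 1 1 - g.val 0 0) = 0 := by
      linear_combination e11 - e00
    exact sub_eq_zero.mp (by simpa [ht] using this)
  refine ⟨g.val 0 0, ?_, ?_⟩
  · intro h0
    rw [d0, h0] at ht
    simp at ht
  · ext i j
    fin_cases i <;> fin_cases j <;> simp [b0, c0, d0]

theorem mul_self_eq_neg_one {A : Matrix (Fin 2) (Fin 2) F} (ht : A.trace = 0) (hd : A.det = 1) :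
    A * A = -1 := by
  rw [Matrix.trace_fin_two] at ht
  rw [Matrix.det_fin_two] at hd
  have h11 : A 1 1 = -A 0 0 := by linear_combination ht
  rw [h11] at hd
  ext i j
  fin_cases i <;> fin_cases j <;> simp [Matrix.mul_apply, Fin.sum_univ_two, h11]
  · linear_combination -hd
  · ring
  · ring
  · linear_combination -hd

theorem mul_eq_neg_mul_swap {A B : Matrix (Fin 2) (Fin 2) F} (hA : A.trace = 0) (hB : B.trace = 0)
    (hAB : (A * B).trace = 0) : B * A = -(A * B) := by
  simp only [Matrix.trace_fin_two, Matrix.mul_apply, Fin.sum_univ_two] at hA hB hAB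
  have hA' : A 1 1 = -A 0 0 := by linear_combination hA
  have hB' : B 1 1 = -B 0 0 := by linear_combination hB
  rw [hA', hB'] at hAB
  ext i j
  fin_cases i <;> fin_cases j <;>
    simp only [Fin.zero_eta, Fin.mk_one, Matrix.mul_apply, Fin.sum_univ_two, Matrix.neg_apply, hA',
      hB']
  · linear_combination hAB
  · ring
  · ring
  · linear_combination hAB

/-- Any two anticommuting square roots of `-1` are simultaneously conjugate to standard ones. -/
theorem exists_conj_quaternion (h2 : (2 : F) ≠ 0) {A B : Matrix (Fin 2) (Fin 2) F}
    (hA : A * A = -1) (hB : B * B = -1) (hBA : B * A = -(A * B)) (hBt : B.trace = 0)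
    (hABt : (A * B).trace = 0) {x y : F} (hxy : x ^ 2 + y ^ 2 = -1) :
    ∃ P : GL (Fin 2) F, A * P.val = P.val * !![0, -1; 1, 0] ∧
      B * P.val = P.val * !![-y, x; x, y] := by
  obtain ⟨Z, hZ⟩ : ∃ Z, Z = y • B + x • (A * B) := ⟨_, rfl⟩
  have hZt : Z.trace = 0 := by simp [hZ, hBt, hABt]
  have hAAB : A * (A * B) = -B := by rw [← mul_assoc, hA]; simp
  have hBAB : B * (A * B) = A := by rw [← mul_assoc, hBA, neg_mul, mul_assoc, hB]; simp
  have hABB : A * B * B = -A := by rw [mul_assoc, hB]; simp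
  have hABAB : A * B * (A * B) = -1 := by rw [mul_assoc, hBAB, hA]
  have hABA : A * B * A = B := by rw [mul_assoc, hBA, mul_neg, hAAB, neg_neg]
  have hZZ : Z * Z = 1 := by
    have : Z * Z = (-(x ^ 2 + y ^ 2)) • (1 : Matrix (Fin 2) (Fin 2) F) := by
      simp only [hZ, add_mul, mul_add, Matrix.smul_mul, Matrix.mul_smul, hBAB, hABB, hB, hABAB]
      module
    rw [this, hxy]; simp
  have hZA : Z * A = -(A * Z) := by
    simp only [hZ, add_mul, mul_add, Matrix.smul_mul, Matrix.mul_smul, hBA, hABA, hAAB]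
    module
  have hBZ : B = x • (A * Z) - y • Z := by
    have : x • (A * Z) - y • Z = (-(x ^ 2 + y ^ 2)) • B := by
      simp only [hZ, mul_add, Matrix.mul_smul, hAAB]
      module
    rw [this, hxy]; simp
  obtain ⟨v, hv0, hv⟩ : ∃ v : Fin 2 → F, v ≠ 0 ∧ Z *ᵥ v = v := by
    have hne : Z + 1 ≠ 0 := by
      intro h
      have := congrArg Matrix.trace h
      rw [Matrix.trace_add, hZt] at this
      simp at this
      exact h2 this
    have : ∃ w, (Z + 1) *ᵥ w ≠ 0 := by
      by_contra! hc
      exact hne (Matrix.ext_of_mulVec_single fun i => by rw [hc, Matrix.zero_mulVec])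
    obtain ⟨w, hw⟩ := this
    refine ⟨_, hw, ?_⟩
    rw [Matrix.mulVec_mulVec, mul_add, hZZ, mul_one, add_comm]
  have hZAv : Z *ᵥ (A *ᵥ v) = -(A *ᵥ v) := by
    rw [Matrix.mulVec_mulVec, hZA, Matrix.neg_mulVec, ← Matrix.mulVec_mulVec, hv]
  have hAAv : A *ᵥ (A *ᵥ v) = -v := by
    rw [Matrix.mulVec_mulVec, hA, Matrix.neg_mulVec, Matrix.one_mulVec]
  obtain ⟨u, hu⟩ : ∃ u, u = A *ᵥ v := ⟨_, rfl⟩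
  rw [← hu] at hZAv hAAv
  have hBv : B *ᵥ v = x • u - y • v := by
    rw [hBZ, Matrix.sub_mulVec, Matrix.smul_mulVec, Matrix.smul_mulVec, ← Matrix.mulVec_mulVec, hv,
      ← hu]
  have hBu : B *ᵥ u = x • v + y • u := by
    rw [hBZ, Matrix.sub_mulVec, Matrix.smul_mulVec, Matrix.smul_mulVec, ← Matrix.mulVec_mulVec,
      hZAv, Matrix.mulVec_neg, hAAv]
    module
  have hdet : (!![v 0, u 0; v 1, u 1] : Matrix (Fin 2) (Fin 2) F).det ≠ 0 := by
    intro hd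
    obtain ⟨w, hw0, hw⟩ := Matrix.exists_mulVec_eq_zero_iff.mpr hd
    have hlin : w 0 • v + w 1 • u = 0 := by
      ext i
      have := congrFun hw i
      simp only [Matrix.mulVec, dotProduct, Fin.sum_univ_two] at this
      fin_cases i <;> simp at this ⊢ <;> linear_combination this
    have hlin' : w 0 • v - w 1 • u = 0 := by
      have := congrArg (Z *ᵥ ·) hlin
      simpa [Matrix.mulVec_add, Matrix.mulVec_smul, hv, hZAv, sub_eq_add_neg] using this
    have hw0' : w 0 = 0 := by
      have : (2 * w 0) • v = 0 := by
        calc (2 * w 0) • v = (w 0 • v + w 1 • u) + (w 0 • v - w 1 • u) := by module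
          _ = 0 := by rw [hlin, hlin', add_zero]
      simpa [h2, hv0] using this
    have hu0 : u ≠ 0 := by
      rintro rfl
      simp at hAAv
      exact hv0 hAAv
    have hw1' : w 1 = 0 := by simpa [hw0', hu0] using hlin
    exact hw0 (by ext i; fin_cases i <;> simp [hw0', hw1'])
  refine ⟨GeneralLinearGroup.mkOfDetNeZero _ hdet, ?_, ?_⟩
  · have e0 (i) := congrFun hu i
    have e1 (i) := congrFun hAAv i
    simp only [Matrix.mulVec, dotProduct, Fin.sum_univ_two, Pi.neg_apply] at e0 e1
    ext i j
    fin_cases j <;>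
      simp [GeneralLinearGroup.mkOfDetNeZero, Matrix.mul_apply, Fin.sum_univ_two, e1, ← e0] <;>
      fin_cases i <;> simp
  · have e0 (i) := congrFun hBv i
    have e1 (i) := congrFun hBu i
    simp only [Matrix.mulVec, dotProduct, Fin.sum_univ_two, Pi.add_apply, Pi.sub_apply,
      Pi.smul_apply, smul_eq_mul] at e0 e1
    ext i j
    fin_cases j <;>
      simp [GeneralLinearGroup.mkOfDetNeZero, Matrix.mul_apply, Fin.sum_univ_two, e1, e0] <;>
      fin_cases i <;> simp <;> ring

/-- A matrix commuting with both standard quaternion generators is scalar. -/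
theorem eq_smul_one_of_commute (h2 : (2 : F) ≠ 0) {x y : F} (hxy : x ^ 2 + y ^ 2 = -1)
    {M : Matrix (Fin 2) (Fin 2) F} (hA : M * !![0, -1; 1, 0] = !![0, -1; 1, 0] * M)
    (hB : M * !![-y, x; x, y] = !![-y, x; x, y] * M) : M = M 0 0 • 1 := by
  have a (i j) := congrFun (congrFun hA i) j
  have b (i j) := congrFun (congrFun hB i) j
  have a00 := a 0 0
  have a01 := a 0 1
  have b00 := b 0 0
  have b01 := b 0 1
  simp [Matrix.mul_apply, Fin.sum_univ_two] at a00 a01 b00 b01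
  have h11 : M 1 1 = M 0 0 := by linear_combination -a01
  have h01 : M 0 1 = 0 := by
    have : 2 * M 0 1 = 0 := by
      rw [h11] at b01
      linear_combination -y * b01 - x * b00 - x ^ 2 * a00 + 2 * M 0 1 * hxy
    simpa [h2] using this
  have h10 : M 1 0 = 0 := by linear_combination a00 - h01
  ext i j
  fin_cases i <;> fin_cases j <;> simp [h11, h01, h10]

/-- A matrix intertwining the standard quaternion generators with matrices fixed by `σ` is, up to
a scalar, itself fixed by `σ`. -/
theorem exists_smul_map_eq (h2 : (2 : F) ≠ 0) (σ : F →+* F) {x y : F} (hxy : x ^ 2 + y ^ 2 = -1)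
    (hx : σ x = x) (hy : σ y = y) (G : GL (Fin 2) F) {X Y : Matrix (Fin 2) (Fin 2) F}
    (hX : X.map σ = X) (hY : Y.map σ = Y) (hGX : G.val * !![0, -1; 1, 0] = X * G.val)
    (hGY : G.val * !![-y, x; x, y] = Y * G.val) :
    ∃ c : F, c ≠ 0 ∧ (c • G.val).map σ = c • G.val := by
  have hA : (!![0, -1; 1, 0] : Matrix (Fin 2) (Fin 2) F).map σ = !![0, -1; 1, 0] := by
    ext i j; fin_cases i <;> fin_cases j <;> simp
  have hB : (!![-y, x; x, y] : Matrix (Fin 2) (Fin 2) F).map σ = !![-y, x; x, y] := by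
    ext i j; fin_cases i <;> fin_cases j <;> simp [hx, hy]
  have key (C Z : Matrix (Fin 2) (Fin 2) F) (hC : C.map σ = C) (hZ : Z.map σ = Z)
      (h : G.val * C = Z * G.val) :
      (G⁻¹.val * G.val.map σ) * C = C * (G⁻¹.val * G.val.map σ) := by
    have h' := congrArg (fun M => M.map σ) h
    simp only [Matrix.map_mul, hC, hZ] at h'
    have h3 : G⁻¹.val * Z = C * G⁻¹.val := by
      calc G⁻¹.val * Z = G⁻¹.val * (Z * G.val) * G⁻¹.val := by simp [mul_assoc]
        _ = C * G⁻¹.val := by rw [← h, ← mul_assoc]; simp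
    rw [mul_assoc, h', ← mul_assoc, h3, mul_assoc]
  have hs := eq_smul_one_of_commute h2 hxy (key _ _ hA hX hGX) (key _ _ hB hY hGY)
  obtain ⟨t, ht⟩ : ∃ t : F, G⁻¹.val * G.val.map σ = t • 1 := ⟨_, hs⟩
  have hσ : G.val.map σ = t • G.val := by
    calc G.val.map σ = G.val * (G⁻¹.val * G.val.map σ) := by rw [← mul_assoc]; simp
      _ = t • G.val := by rw [ht]; simp
  have hσ' (i j) : σ (G.val i j) = t * G.val i j := by
    simpa using congrFun (congrFun hσ i) j
  obtain ⟨i, j, hij⟩ : ∃ i j, G.val i j ≠ 0 := by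
    by_contra! h0
    exact G.ne_zero (by ext i j; exact h0 i j)
  have ht0 : t ≠ 0 := by
    rintro rfl
    have := hσ' i j
    simp at this
    exact hij this
  refine ⟨(G.val i j)⁻¹, inv_ne_zero hij, ?_⟩
  ext k l
  simp only [Matrix.map_apply, Matrix.smul_apply, smul_eq_mul, map_mul, map_inv₀, hσ']
  field_simp

/-- A subgroup of type `Sym₄` normalizes a quaternion group `{±1, ±A, ±B, ±AB}`. -/
theorem exists_quaternion_lift (f : Equiv.Perm (Fin 4) →* PGL2 F) (hf : Function.Injective f) :
    ∃ A B : Matrix (Fin 2) (Fin 2) F, A.trace = 0 ∧ B.trace = 0 ∧ (A * B).trace = 0 ∧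
      A.det = 1 ∧ B.det = 1 ∧ ∀ s, ∀ G : GL (Fin 2) F, (G : PGL2 F) = f s →
        ∀ C, C = A ∨ C = B → ∃ c : F, (c = 1 ∨ c = -1) ∧ ∃ X, (X = A ∨ X = B ∨ X = A * B) ∧
          G.val * C = c • X * G.val := by
  obtain ⟨a, b, t, ha, hb, hab, ha1, hb1, hab1, hta, htb, hconj⟩ :
      ∃ a b t : Equiv.Perm (Fin 4), a * a = 1 ∧ b * b = 1 ∧ (a * b) * (a * b) = 1 ∧
        a ≠ 1 ∧ b ≠ 1 ∧ a * b ≠ 1 ∧ b = t * a * t⁻¹ ∧ t * b = a * b * t ∧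
        ∀ s, (s * a = a * s ∨ s * a = b * s ∨ s * a = a * b * s) ∧
          (s * b = a * s ∨ s * b = b * s ∨ s * b = a * b * s) := by
    refine ⟨Equiv.swap 0 1 * Equiv.swap 2 3, Equiv.swap 0 2 * Equiv.swap 1 3,
      Equiv.swap 1 2 * Equiv.swap 2 3, ?_⟩
    decide
  obtain ⟨A, hA⟩ := QuotientGroup.mk_surjective (f a)
  obtain ⟨T, hT⟩ := QuotientGroup.mk_surjective (f t)
  obtain ⟨B, hBdef⟩ : ∃ B, B = T * A * T⁻¹ := ⟨_, rfl⟩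
  have hB : (B : PGL2 F) = f b := by simp [hBdef, hta, hA, hT]
  have hAB : ((A * B : GL (Fin 2) F) : PGL2 F) = f (a * b) := by simp [hA, hB]
  have htr (g) (G : GL (Fin 2) F) (hG : (G : PGL2 F) = f g) (h1 : g * g = 1) (h2 : g ≠ 1) :
      G.val.trace = 0 := by
    apply trace_eq_zero_of_mk_sq_eq_one
    · rw [hG, ← map_mul, h1, map_one]
    · rw [hG]
      exact fun h => h2 (hf (by rw [h, map_one]))
  have hlift (s r q) (G R Q : GL (Fin 2) F) (hG : (G : PGL2 F) = f s) (hR : (R : PGL2 F) = f r)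
      (hQ : (Q : PGL2 F) = f q) (h : s * r = q * s) :
      ∃ c : F, c ≠ 0 ∧ G.val * R.val = c • (Q.val * G.val) := by
    have : ((Q * G : GL (Fin 2) F) : PGL2 F) = (G * R : GL (Fin 2) F) := by
      rw [QuotientGroup.mk_mul, QuotientGroup.mk_mul, hG, hR, hQ, ← map_mul, ← map_mul, h]
    simpa using mk_eq_mk_iff.mp this
  have hdet (G : GL (Fin 2) F) : G.val.det ≠ 0 := G.det.ne_zero
  have hdetc (G R Q : Matrix (Fin 2) (Fin 2) F) (hG : G.det ≠ 0) (c : F)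
      (h : G * R = c • (Q * G)) : R.det = c ^ 2 * Q.det := by
    have := congrArg Matrix.det h
    rw [Matrix.det_mul, Matrix.det_smul, Matrix.det_mul, Fintype.card_fin] at this
    exact mul_left_cancel₀ hG (by linear_combination this)
  have hdAB : B.val.det = A.val.det := by
    have := hdetc T.val A.val B.val (hdet T) 1 (by simp [hBdef])
    simpa using this.symm
  obtain ⟨μ, hμ0, hμ⟩ := hlift _ _ _ _ _ _ hT hB hAB htb
  have hμd := hdetc _ _ _ (hdet T) _ hμ
  obtain ⟨d, hd⟩ : ∃ d, d = A.val.det := ⟨_, rfl⟩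
  have hd0 : d ≠ 0 := hd ▸ hdet A
  rw [Units.val_mul, Matrix.det_mul, hdAB, ← hd] at hμd
  obtain ⟨r, hr⟩ : ∃ r, r = (μ * d)⁻¹ := ⟨_, rfl⟩
  have hr0 : r ≠ 0 := hr ▸ inv_ne_zero (mul_ne_zero hμ0 hd0)
  have hrd : r ^ 2 * d = 1 := by
    rw [hr]
    field_simp
    exact mul_left_cancel₀ hd0 (by linear_combination hμd)
  have hdA1 : (r • A.val).det = 1 := by rw [Matrix.det_smul, Fintype.card_fin, ← hd, hrd]
  have hdB1 : (r • B.val).det = 1 := by rw [Matrix.det_smul, Fintype.card_fin, hdAB, ← hd, hrd]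
  have hdAB1 : ((r • A.val) * (r • B.val)).det = 1 := by rw [Matrix.det_mul, hdA1, hdB1, one_mul]
  have htAB := htr _ _ hAB hab hab1
  rw [Units.val_mul] at htAB
  refine ⟨r • A.val, r • B.val, by simp [htr _ _ hA ha ha1], by simp [htr _ _ hB hb hb1],
    by simp [htAB], hdA1, hdB1, ?_⟩
  intro s G hG
  have hsign (R X : Matrix (Fin 2) (Fin 2) F) (hR : R.det = 1) (hX : X.det = 1) (c : F)
      (h : G.val * R = c • (X * G.val)) : c = 1 ∨ c = -1 := by
    have := hdetc _ _ _ (hdet G) _ h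
    rw [hR, hX, mul_one] at this
    exact mul_self_eq_one_iff.mp (by rw [← sq, ← this])
  have hmain (q) (Q : GL (Fin 2) F) (hQ : (Q : PGL2 F) = f q) (hQd : (r • Q.val).det = 1)
      (hq : s * q = a * s ∨ s * q = b * s ∨ s * q = a * b * s) :
      ∃ c : F, (c = 1 ∨ c = -1) ∧ ∃ X, (X = r • A.val ∨ X = r • B.val ∨
        X = r • A.val * r • B.val) ∧ G.val * r • Q.val = c • X * G.val := by
    rcases hq with hq | hq | hq
    · obtain ⟨c, -, h⟩ := hlift _ _ _ _ _ _ hG hQ hA hq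
      have h' : G.val * r • Q.val = c • (r • A.val * G.val) := by
        rw [Matrix.mul_smul, h, Matrix.smul_mul, smul_comm]
      exact ⟨c, hsign _ _ hQd hdA1 _ h', _, .inl rfl, by simp only [h', Matrix.smul_mul]⟩
    · obtain ⟨c, -, h⟩ := hlift _ _ _ _ _ _ hG hQ hB hq
      have h' : G.val * r • Q.val = c • (r • B.val * G.val) := by
        rw [Matrix.mul_smul, h, Matrix.smul_mul, smul_comm]
      exact ⟨c, hsign _ _ hQd hdB1 _ h', _, .inr (.inl rfl), by simp only [h', Matrix.smul_mul]⟩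
    · obtain ⟨c, -, h⟩ := hlift _ _ _ _ _ _ hG hQ hAB hq
      have h' : G.val * r • Q.val = (c * r⁻¹) • (r • A.val * r • B.val * G.val) := by
        rw [Matrix.mul_smul, h, Units.val_mul]
        simp only [Matrix.smul_mul, Matrix.mul_smul, smul_smul]
        congr 1
        field_simp
      exact ⟨_, hsign _ _ hQd hdAB1 _ h', _, .inr (.inr rfl), by simp only [h', Matrix.smul_mul]⟩
  rintro C (rfl | rfl)
  · exact hmain a A hA hdA1 (hconj s).1
  · exact hmain b B hB hdB1 (hconj s).2

end Field

/-- The homomorphism of projective linear groups induced by a field extension. -/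
def map {K F : Type*} [Field K] [Field F] (φ : K →+* F) : PGL2 K →* PGL2 F :=
  QuotientGroup.map _ _ (GeneralLinearGroup.map φ) (GeneralLinearGroup.map_center_le φ)

theorem map_injective {K F : Type*} [Field K] [Field F] (φ : K →+* F) :
    Function.Injective (map φ) := by
  rw [injective_iff_map_eq_one]
  intro g
  induction g using QuotientGroup.induction_on with | H g => ?_
  intro h
  rw [QuotientGroup.eq_one_iff, GeneralLinearGroup.mem_center_iff_val_mem_range_scalar]
  have h' : GeneralLinearGroup.map φ g ∈ Subgroup.center (GL (Fin 2) F) :=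
    (QuotientGroup.eq_one_iff _).mp h
  rw [GeneralLinearGroup.mem_center_iff_val_mem_range_scalar] at h'
  obtain ⟨c, hc⟩ := h'
  have e (i j) : Matrix.scalar (Fin 2) c i j = φ (g.val i j) := congrFun (congrFun hc i) j
  refine ⟨g.val 0 0, ?_⟩
  ext i j
  apply φ.injective
  have e00 := e 0 0
  rw [← e i j]
  fin_cases i <;> fin_cases j <;> simp at e00 ⊢ <;> exact e00.symm

theorem exists_algebraMap_eq {p : ℕ} [Fact p.Prime] {F : Type*} [Field F] [Algebra (ZMod p) F]
    [CharP F p] {x : F} (hx : x ^ p = x) : ∃ z : ZMod p, algebraMap (ZMod p) F z = x := by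
  have h := (Subfield.mem_bot_iff_pow_eq_self F p).mpr hx
  exact (bot_le : (⊥ : Subfield F) ≤ (algebraMap (ZMod p) F).fieldRange) h

/-- Every copy of `Sym₄` in `PGL₂(F)`, `F` of odd characteristic `p`, is conjugate into
`PGL₂(𝔽_p)`. -/
theorem exists_conj_mem_range_map {p : ℕ} [Fact p.Prime] (hp : Odd p) {F : Type*} [Field F]
    [Algebra (ZMod p) F] (f : Equiv.Perm (Fin 4) →* PGL2 F) (hf : Function.Injective f) :
    ∃ P : PGL2 F, ∀ s, ∃ m, f s = P * map (algebraMap (ZMod p) F) m * P⁻¹ := by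
  have : CharP F p := charP_of_injective_algebraMap (algebraMap (ZMod p) F).injective p
  have h2 : (2 : F) ≠ 0 := Ring.two_ne_zero (by
    rw [ringChar.eq F p]
    rintro rfl
    exact absurd hp (by decide))
  obtain ⟨x₀, y₀, hxy₀⟩ := ZMod.sq_add_sq p (-1)
  obtain ⟨x, hx⟩ : ∃ x, x = algebraMap (ZMod p) F x₀ := ⟨_, rfl⟩
  obtain ⟨y, hy⟩ : ∃ y, y = algebraMap (ZMod p) F y₀ := ⟨_, rfl⟩
  have hxy : x ^ 2 + y ^ 2 = -1 := by
    rw [hx, hy, ← map_pow, ← map_pow, ← map_add, hxy₀, map_neg, map_one]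
  have hσx : frobenius F p x = x := by rw [frobenius_def, hx, ← map_pow, ZMod.pow_card]
  have hσy : frobenius F p y = y := by rw [frobenius_def, hy, ← map_pow, ZMod.pow_card]
  obtain ⟨A, B, hAt, hBt, hABt, hAd, hBd, hS⟩ := exists_quaternion_lift f hf
  obtain ⟨P, hPA, hPB⟩ := exists_conj_quaternion h2 (mul_self_eq_neg_one hAt hAd)
    (mul_self_eq_neg_one hBt hBd) (mul_eq_neg_mul_swap hAt hBt hABt) hBt hABt hxy
  refine ⟨P, fun s => ?_⟩
  obtain ⟨G, hG⟩ := QuotientGroup.mk_surjective (f s)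
  have hAσ : (!![0, -1; 1, 0] : Matrix (Fin 2) (Fin 2) F).map (frobenius F p) = !![0, -1; 1, 0] := by
    ext i j; fin_cases i <;> fin_cases j <;> simp
  have hBσ : (!![-y, x; x, y] : Matrix (Fin 2) (Fin 2) F).map (frobenius F p) =
      !![-y, x; x, y] := by
    ext i j; fin_cases i <;> fin_cases j <;> simp only [Matrix.map_apply] <;> simp [hσx, hσy]
  have hX (X) (h : X = A ∨ X = B ∨ X = A * B) :
      ∃ X₀, X * P.val = P.val * X₀ ∧ X₀.map (frobenius F p) = X₀ := by
    rcases h with rfl | rfl | rfl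
    · exact ⟨_, hPA, hAσ⟩
    · exact ⟨_, hPB, hBσ⟩
    · refine ⟨_, by rw [mul_assoc, hPB, ← mul_assoc, hPA, mul_assoc], ?_⟩
      rw [Matrix.map_mul, hAσ, hBσ]
  have key (C C₀) (hC : C = A ∨ C = B) (hCP : C * P.val = P.val * C₀) :
      ∃ Y : Matrix (Fin 2) (Fin 2) F, Y.map (frobenius F p) = Y ∧
        (P⁻¹ * G * P).val * C₀ = Y * (P⁻¹ * G * P).val := by
    obtain ⟨c, hc, X, hXmem, h⟩ := hS s G hG C hC
    obtain ⟨X₀, hX₀, hX₀σ⟩ := hX X hXmem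
    have hPX : P⁻¹.val * X = X₀ * P⁻¹.val := by
      calc P⁻¹.val * X = P⁻¹.val * (X * P.val) * P⁻¹.val := by simp [mul_assoc]
        _ = X₀ * P⁻¹.val := by rw [hX₀, ← mul_assoc]; simp
    refine ⟨c • X₀, ?_, ?_⟩
    · have hcσ : frobenius F p c = c := by rcases hc with rfl | rfl <;> simp
      ext i j
      have := congrFun (congrFun hX₀σ i) j
      simp only [Matrix.map_apply] at this
      simp only [Matrix.map_apply, Matrix.smul_apply, smul_eq_mul, map_mul, hcσ, this]
    · calc (P⁻¹ * G * P).val * C₀ = P⁻¹.val * (G.val * (P.val * C₀)) := by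
            simp only [Units.val_mul, mul_assoc]
        _ = P⁻¹.val * ((G.val * C) * P.val) := by rw [← hCP]; simp only [mul_assoc]
        _ = c • ((P⁻¹.val * X) * (G.val * P.val)) := by
            rw [h]; simp only [Matrix.smul_mul, Matrix.mul_smul, mul_assoc]
        _ = c • X₀ * (P⁻¹ * G * P).val := by
            rw [hPX]; simp only [Matrix.smul_mul, Units.val_mul, mul_assoc]
  obtain ⟨X, hXσ, hGX⟩ := key A _ (.inl rfl) hPA
  obtain ⟨Y, hYσ, hGY⟩ := key B _ (.inr rfl) hPB
  obtain ⟨c, hc0, hc⟩ := exists_smul_map_eq h2 (frobenius F p) hxy hσx hσy _ hXσ hYσ hGX hGY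
  have hfix (i j) : ∃ z : ZMod p, algebraMap (ZMod p) F z = (c • (P⁻¹ * G * P).val) i j :=
    exists_algebraMap_eq (congrFun (congrFun hc i) j)
  choose M hM using hfix
  have hM' : (Matrix.of M).map (algebraMap (ZMod p) F) = c • (P⁻¹ * G * P).val := by
    ext i j; exact hM i j
  have hMdet : (Matrix.of M).det ≠ 0 := by
    intro h
    have h' := congrArg (algebraMap (ZMod p) F) h
    rw [RingHom.map_det, RingHom.mapMatrix_apply, hM', Matrix.det_smul, map_zero] at h'
    exact mul_ne_zero (pow_ne_zero _ hc0) (P⁻¹ * G * P).det.ne_zero h'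
  refine ⟨(GeneralLinearGroup.mkOfDetNeZero _ hMdet : GL (Fin 2) (ZMod p)), ?_⟩
  have hmk : ((P⁻¹ * G * P : GL (Fin 2) F) : PGL2 F) = map (algebraMap (ZMod p) F)
      (GeneralLinearGroup.mkOfDetNeZero _ hMdet : GL (Fin 2) (ZMod p)) :=
    mk_eq_mk_iff.mpr ⟨c, hc0, hM'⟩
  rw [← hmk, ← hG]
  simp only [QuotientGroup.mk_mul, QuotientGroup.mk_inv]
  group

end PGL2

/-- Every copy of `Sym₄` inside `PGL₂(𝔽_{p^k})`, `p` an odd prime, is contained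
in a subfield subgroup isomorphic to `PGL₂(𝔽_p)`. -/
theorem sym4_in_subfield_PGL2
    (p : ℕ) [Fact p.Prime] (hp : Odd p) (k : ℕ) (hk : 0 < k)
    (S : Subgroup (PGL2 (GaloisField p k)))
    (hS : Nonempty (S ≃* Equiv.Perm (Fin 4))) :
    ∃ H : Subgroup (PGL2 (GaloisField p k)),
      S ≤ H ∧ Nonempty (H ≃* PGL2 (ZMod p)) := by
  obtain ⟨e⟩ := hS
  obtain ⟨P, hP⟩ := PGL2.exists_conj_mem_range_map hp (S.subtype.comp e.symm.toMonoidHom)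
    (S.subtype_injective.comp e.symm.injective)
  have hinj : Function.Injective ((MulAut.conj P).toMonoidHom.comp
      (PGL2.map (algebraMap (ZMod p) (GaloisField p k)))) :=
    (MulAut.conj P).injective.comp (PGL2.map_injective _)
  refine ⟨MonoidHom.range _, fun g hg => ?_, ⟨(MonoidHom.ofInjective hinj).symm⟩⟩
  obtain ⟨m, hm⟩ := hP (e ⟨g, hg⟩)
  exact ⟨m, by simpa using hm.symm⟩
end

section
/- Let q be an odd prime power. Then PSL₂(𝔽_q) contains a subgroup isomorphic to the symmetric group on 4 letters if and only if q ≡ 1 (mod 8) or q ≡ 7 (mod 8). -/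
open Matrix

/-- `PSL₂(F)`: the quotient of `SL₂(F)` by its center. -/
abbrev PSL2 (F : Type*) [Field F] : Type _ :=
  Matrix.SpecialLinearGroup (Fin 2) F ⧸
    Subgroup.center (Matrix.SpecialLinearGroup (Fin 2) F)

namespace PSL2

variable {F : Type*} [Field F]

theorem mem_center_of_coe_eq_smul_one {A : Matrix.SpecialLinearGroup (Fin 2) F} {r : F}
    (h : (A : Matrix (Fin 2) (Fin 2) F) = r • 1) :
    A ∈ Subgroup.center (Matrix.SpecialLinearGroup (Fin 2) F) := by
  refine Subgroup.mem_center_iff.2 fun B => Subtype.ext ?_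
  rw [Matrix.SpecialLinearGroup.coe_mul, Matrix.SpecialLinearGroup.coe_mul, h]
  simp

/-- An element of order four in `PSL₂(F)` lifts to a matrix of trace `t` with `t ^ 2 = 2`. -/
theorem isSquare_two_of_orderOf_eq_four {x : PSL2 F} (hx : orderOf x = 4) :
    IsSquare (2 : F) := by
  obtain ⟨A, rfl⟩ := QuotientGroup.mk_surjective x
  have h4 : A ^ 4 ∈ Subgroup.center (Matrix.SpecialLinearGroup (Fin 2) F) := by
    rw [← QuotientGroup.eq_one_iff, QuotientGroup.mk_pow, ← hx, pow_orderOf_eq_one]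
  have h2 : A ^ 2 ∉ Subgroup.center (Matrix.SpecialLinearGroup (Fin 2) F) := by
    rw [← QuotientGroup.eq_one_iff, QuotientGroup.mk_pow]
    exact pow_ne_one_of_lt_orderOf (by norm_num) (by omega)
  set M : Matrix (Fin 2) (Fin 2) F := A.1 with hM
  set t := M 0 0 + M 1 1 with ht
  have hdet : M 0 0 * M 1 1 - M 0 1 * M 1 0 = 1 := by
    rw [← Matrix.det_fin_two]; exact A.2
  have hsq : M ^ 2 = t • M - 1 := by
    ext i j
    fin_cases i <;> fin_cases j <;>
      simp [pow_two, Matrix.mul_apply, Fin.sum_univ_two, ht] <;>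
      first | ring1 | linear_combination -hdet
  have hpow : M ^ 4 = (t * (t ^ 2 - 2)) • M + (1 - t ^ 2) • 1 := by
    rw [show M ^ 4 = (t • M - 1) * (t • M - 1) by rw [← hsq, ← pow_add]]
    simp only [sub_mul, mul_sub, smul_mul_assoc, mul_smul_comm, mul_one, one_mul]
    rw [← pow_two M, hsq]
    module
  obtain ⟨r, -, hr⟩ := Matrix.SpecialLinearGroup.mem_center_iff.1 h4
  have hr' : M ^ 4 = r • 1 := by
    rw [hM, ← Matrix.SpecialLinearGroup.coe_pow, ← hr, Matrix.smul_one_eq_diagonal]; rfl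
  by_cases ht0 : t = 0
  · refine absurd (mem_center_of_coe_eq_smul_one (r := -1) ?_) h2
    rw [Matrix.SpecialLinearGroup.coe_pow, ← hM, hsq, ht0]
    module
  by_cases ht2 : t ^ 2 - 2 = 0
  · exact ⟨t, by linear_combination -ht2⟩
  set c := t * (t ^ 2 - 2) with hc
  have hc0 : c ≠ 0 := mul_ne_zero ht0 ht2
  have hscalar : M = (c⁻¹ * (r - 1 + t ^ 2)) • 1 := by
    have : c • M = (r - 1 + t ^ 2) • 1 := by
      rw [← sub_eq_zero, ← sub_eq_zero.2 (hpow.symm.trans hr')]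
      module
    rw [mul_smul, ← this, smul_smul, inv_mul_cancel₀ hc0, one_smul]
  exact absurd (pow_mem (mem_center_of_coe_eq_smul_one hscalar) 2) h2

/-- The four diagonals `±i ± j ± k` (with an even number of minus signs) of the cube spanned by the
quaternion units `i, j, k`, realised as `2 × 2` matrices by means of `a ^ 2 + b ^ 2 = -1`. -/
def cubeDiagonal (a b : F) : Fin 4 → Matrix (Fin 2) (Fin 2) F :=
  ![!![a + b, 1 + b - a; -1 + b - a, -a - b],
    !![-a - b, 1 - b + a; -1 - b + a, a + b],
    !![a - b, -1 + b + a; 1 + b + a, b - a],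
    !![b - a, -1 - b - a; 1 - b - a, a - b]]

variable {a b : F}

theorem cubeDiagonal_mul_self (hab : a ^ 2 + b ^ 2 = -1) (n : Fin 4) :
    cubeDiagonal a b n * cubeDiagonal a b n = (-3 : F) • 1 := by
  fin_cases n <;> ext i j <;> fin_cases i <;> fin_cases j <;>
    simp [cubeDiagonal, Matrix.mul_apply, Fin.sum_univ_two] <;>
    first | ring1 | linear_combination 2 * hab

theorem cubeDiagonal_anticomm (hab : a ^ 2 + b ^ 2 = -1) {n m : Fin 4} (h : n ≠ m) :
    cubeDiagonal a b n * cubeDiagonal a b m + cubeDiagonal a b m * cubeDiagonal a b n =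
      (2 : F) • 1 := by
  fin_cases n <;> fin_cases m <;> first | exact absurd rfl h | skip
  all_goals
    ext i j
    fin_cases i <;> fin_cases j <;>
      simp [cubeDiagonal] <;> first | ring1 | linear_combination -4 * hab

theorem det_cubeDiagonal_sub (hab : a ^ 2 + b ^ 2 = -1) {n m : Fin 4} (h : n ≠ m) :
    (cubeDiagonal a b n - cubeDiagonal a b m).det = 8 := by
  fin_cases n <;> fin_cases m <;> first | exact absurd rfl h | skip
  all_goals
    simp [cubeDiagonal, Matrix.det_fin_two]
    first | ring1 | linear_combination -4 * hab | linear_combination -8 * hab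

/-- Distinct diagonals are not proportional by a sign. -/
theorem eq_of_cubeDiagonal_eq_units_smul (h2 : (2 : F) ≠ 0) (hab : a ^ 2 + b ^ 2 = -1)
    (u : ℤˣ) {n m : Fin 4} (h : cubeDiagonal a b n = u • cubeDiagonal a b m) : n = m := by
  by_contra hne
  have hnm := cubeDiagonal_anticomm hab hne
  have h4 : (4 : F) ≠ 0 := by
    rw [show (4 : F) = 2 * 2 by norm_num]; exact mul_ne_zero h2 h2
  have h8 : (8 : F) ≠ 0 := by
    rw [show (8 : F) = 4 * 2 by norm_num]; exact mul_ne_zero h4 h2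
  rcases Int.units_eq_one_or u with rfl | rfl
  · rw [one_smul] at h
    rw [h, cubeDiagonal_mul_self hab] at hnm
    have := congrFun (congrFun hnm 0) 0
    simp at this
    exact h8 (by linear_combination -this)
  · rw [Units.neg_smul, one_smul] at h
    rw [h, neg_mul, mul_neg, cubeDiagonal_mul_self hab] at hnm
    have := congrFun (congrFun hnm 0) 0
    simp at this
    exact h4 (by linear_combination this)

/-- The pairs `(g, σ)` such that conjugation by `g` takes the diagonal `n` to the diagonal `σ n`
times the sign of `σ`. -/
def diagonalRelation (a b : F) :
    Subgroup (Matrix.SpecialLinearGroup (Fin 2) F × Equiv.Perm (Fin 4)) where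
  carrier := {x | ∀ n, (x.1 : Matrix (Fin 2) (Fin 2) F) * cubeDiagonal a b n =
    Equiv.Perm.sign x.2 • (cubeDiagonal a b (x.2 n) * (x.1 : Matrix (Fin 2) (Fin 2) F))}
  one_mem' n := by simp
  mul_mem' {x y} hx hy n := by
    simp only [Set.mem_ofPred_eq] at hx hy
    simp only [Prod.fst_mul, Prod.snd_mul, Matrix.SpecialLinearGroup.coe_mul, Equiv.Perm.sign_mul,
      Equiv.Perm.mul_apply]
    rw [mul_assoc, hy, mul_smul_comm, ← mul_assoc, hx, smul_mul_assoc, smul_smul, mul_assoc,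
      mul_comm (Equiv.Perm.sign y.2)]
  inv_mem' {x} hx n := by
    simp only [Set.mem_ofPred_eq] at hx
    have h := hx (x.2⁻¹ n)
    have hl : ((x.1⁻¹ : Matrix.SpecialLinearGroup (Fin 2) F) :
        Matrix (Fin 2) (Fin 2) F) * x.1 = 1 := by
      rw [← Matrix.SpecialLinearGroup.coe_mul, inv_mul_cancel, Matrix.SpecialLinearGroup.coe_one]
    have hr : (x.1 : Matrix (Fin 2) (Fin 2) F) *
        (x.1⁻¹ : Matrix.SpecialLinearGroup (Fin 2) F) = 1 := by
      rw [← Matrix.SpecialLinearGroup.coe_mul, mul_inv_cancel, Matrix.SpecialLinearGroup.coe_one]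
    rw [← Equiv.Perm.mul_apply, mul_inv_cancel, Equiv.Perm.one_apply] at h
    have h' := congrArg (fun M => ((x.1⁻¹ : Matrix.SpecialLinearGroup (Fin 2) F) :
      Matrix (Fin 2) (Fin 2) F) * M * (x.1⁻¹ : Matrix.SpecialLinearGroup (Fin 2) F)) h
    simp only [← mul_assoc, hl, one_mul, mul_smul_comm, smul_mul_assoc] at h'
    rw [mul_assoc _ (x.1 : Matrix (Fin 2) (Fin 2) F), hr, mul_one] at h'
    simp only [Prod.fst_inv, Prod.snd_inv, Equiv.Perm.sign_inv]
    rw [h', smul_smul, Int.units_mul_self, one_smul]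

theorem mem_diagonalRelation {g : Matrix.SpecialLinearGroup (Fin 2) F} {σ : Equiv.Perm (Fin 4)} :
    (g, σ) ∈ diagonalRelation a b ↔ ∀ n, (g : Matrix (Fin 2) (Fin 2) F) * cubeDiagonal a b n =
      Equiv.Perm.sign σ • (cubeDiagonal a b (σ n) * (g : Matrix (Fin 2) (Fin 2) F)) :=
  Iff.rfl

theorem exists_mem_diagonalRelation_swap (h2 : (2 : F) ≠ 0) (hab : a ^ 2 + b ^ 2 = -1)
    (hs : IsSquare (2 : F)) {n m : Fin 4} (hnm : n ≠ m) :
    ∃ g, (g, Equiv.swap n m) ∈ diagonalRelation a b := by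
  obtain ⟨s, hs⟩ := hs
  have hs0 : s ≠ 0 := by rintro rfl; simp [h2] at hs
  have hdet : ((2 * s)⁻¹ • (cubeDiagonal a b n - cubeDiagonal a b m)).det = 1 := by
    rw [Matrix.det_smul, det_cubeDiagonal_sub hab hnm, Fintype.card_fin]
    field_simp
    linear_combination 4 * hs
  refine ⟨⟨_, hdet⟩, mem_diagonalRelation.2 fun l => ?_⟩
  simp only [Equiv.Perm.sign_swap hnm, Units.neg_smul, one_smul, smul_mul_assoc, mul_smul_comm]
  rw [← smul_neg]
  congr 1
  by_cases hln : l = n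
  · subst hln
    rw [Equiv.swap_apply_left, mul_sub, sub_mul, cubeDiagonal_mul_self hab,
      cubeDiagonal_mul_self hab]
    abel
  by_cases hlm : l = m
  · subst hlm
    rw [Equiv.swap_apply_right, mul_sub, sub_mul, cubeDiagonal_mul_self hab,
      cubeDiagonal_mul_self hab]
    abel
  rw [Equiv.swap_apply_of_ne_of_ne hln hlm, mul_sub, sub_mul,
    eq_sub_of_add_eq (cubeDiagonal_anticomm hab (Ne.symm hln)),
    eq_sub_of_add_eq (cubeDiagonal_anticomm hab (Ne.symm hlm))]
  abel

theorem exists_mem_diagonalRelation (h2 : (2 : F) ≠ 0) (hab : a ^ 2 + b ^ 2 = -1)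
    (hs : IsSquare (2 : F)) (σ : Equiv.Perm (Fin 4)) : ∃ g, (g, σ) ∈ diagonalRelation a b := by
  induction σ using Equiv.Perm.swap_induction_on with
  | one => exact ⟨1, one_mem _⟩
  | swap_mul f x y hxy ih =>
    obtain ⟨g, hg⟩ := ih
    obtain ⟨g', hg'⟩ := exists_mem_diagonalRelation_swap h2 hab hs hxy
    exact ⟨g' * g, mul_mem hg' hg⟩

theorem eq_one_iff_of_mem_diagonalRelation (h2 : (2 : F) ≠ 0) (hab : a ^ 2 + b ^ 2 = -1)
    {g : Matrix.SpecialLinearGroup (Fin 2) F} {σ : Equiv.Perm (Fin 4)}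
    (h : (g, σ) ∈ diagonalRelation a b) :
    σ = 1 ↔ g ∈ Subgroup.center (Matrix.SpecialLinearGroup (Fin 2) F) := by
  rw [mem_diagonalRelation] at h
  constructor
  · rintro rfl
    have h0 := h 0
    have h1 := h 1
    have h3 := h 2
    simp only [Equiv.Perm.sign_one, one_smul, Equiv.Perm.one_apply] at h0 h1 h3
    set M : Matrix (Fin 2) (Fin 2) F := g.1 with hM
    have hi : M * !![0, 1; -1, 0] = !![0, 1; -1, 0] * M := by
      have hd : (2 : F) • !![0, 1; -1, 0] = cubeDiagonal a b 0 + cubeDiagonal a b 1 := by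
        ext i j; fin_cases i <;> fin_cases j <;> simp [cubeDiagonal] <;> ring
      refine smul_right_injective _ h2 ?_
      beta_reduce
      rw [← mul_smul_comm, ← smul_mul_assoc, hd, mul_add, add_mul, h0, h1]
    have hj : M * !![a, b; b, -a] = !![a, b; b, -a] * M := by
      have hd : (2 : F) • !![a, b; b, -a] = cubeDiagonal a b 0 + cubeDiagonal a b 2 := by
        ext i j; fin_cases i <;> fin_cases j <;> simp [cubeDiagonal] <;> ring
      refine smul_right_injective _ h2 ?_
      beta_reduce
      rw [← mul_smul_comm, ← smul_mul_assoc, hd, mul_add, add_mul, h0, h3]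
    have e1 := congrFun (congrFun hi 0) 0
    have e2 := congrFun (congrFun hi 0) 1
    have e3 := congrFun (congrFun hj 0) 0
    have e4 := congrFun (congrFun hj 0) 1
    simp [Matrix.mul_apply, Fin.sum_univ_two] at e1 e2 e3 e4
    have hx : M 0 1 = 0 := by
      refine (mul_eq_zero.1 ?_).resolve_left h2
      linear_combination 2 * M 0 1 * hab - b * e3 + a * e4 + b ^ 2 * e1 - a * b * e2
    have hy : M 1 0 = 0 := by linear_combination -e1 - hx
    have hscalar : M = M 0 0 • 1 := by
      ext i j
      fin_cases i <;> fin_cases j <;> simp [hx, hy, e2]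
    exact mem_center_of_coe_eq_smul_one hscalar
  · intro hg
    obtain ⟨r, hr, hgr⟩ := Matrix.SpecialLinearGroup.mem_center_iff.1 hg
    have hr0 : r ≠ 0 := by rintro rfl; simp at hr
    ext1 n
    refine (eq_of_cubeDiagonal_eq_units_smul h2 hab (Equiv.Perm.sign σ) ?_).symm
    have := h n
    rw [← hgr, Matrix.scalar_apply, ← Matrix.smul_one_eq_diagonal, smul_mul_assoc, one_mul,
      mul_smul_comm, mul_one, smul_comm] at this
    exact smul_right_injective _ hr0 this

theorem exists_subgroup_equiv_perm (h2 : (2 : F) ≠ 0) (hab : a ^ 2 + b ^ 2 = -1)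
    (hs : IsSquare (2 : F)) : ∃ S : Subgroup (PSL2 F), Nonempty (S ≃* Equiv.Perm (Fin 4)) := by
  let π : diagonalRelation a b →* Equiv.Perm (Fin 4) :=
    (MonoidHom.snd _ _).comp (diagonalRelation a b).subtype
  let ρ : diagonalRelation a b →* PSL2 F :=
    ((QuotientGroup.mk' _).comp (MonoidHom.fst _ _)).comp (diagonalRelation a b).subtype
  have hπ : Function.Surjective π := fun σ =>
    let ⟨g, hg⟩ := exists_mem_diagonalRelation h2 hab hs σ
    ⟨⟨(g, σ), hg⟩, rfl⟩
  have hker : ρ.ker = π.ker := by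
    ext ⟨⟨g, σ⟩, h⟩
    rw [MonoidHom.mem_ker, MonoidHom.mem_ker]
    exact (QuotientGroup.eq_one_iff g).trans (eq_one_iff_of_mem_diagonalRelation h2 hab h).symm
  exact ⟨ρ.range, ⟨(QuotientGroup.quotientKerEquivRange ρ).symm.trans
    ((QuotientGroup.quotientMulEquivOfEq hker).trans
      (QuotientGroup.quotientKerEquivOfSurjective π hπ))⟩⟩

end PSL2

/-- Remark 2.1(1) of the paper: `PSL₂(𝔽_q)`, `q` an odd prime power, contains a
subgroup isomorphic to `Sym₄` if and only if `q ≡ ±1 (mod 8)`. -/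
theorem sym4_subgroup_PSL2_iff
    (p : ℕ) [Fact p.Prime] (hp : Odd p) (k : ℕ) (hk : 0 < k)
    (q : ℕ) (hq : q = p ^ k) :
    (∃ S : Subgroup (PSL2 (GaloisField p k)), Nonempty (S ≃* Equiv.Perm (Fin 4))) ↔
      (q % 8 = 1 ∨ q % 8 = 7) := by
  have : Fintype (GaloisField p k) := Fintype.ofFinite _
  have hcard : Fintype.card (GaloisField p k) = q := by
    rw [Fintype.card_eq_nat_card, GaloisField.card p k hk.ne', hq]
  have hodd : q % 2 = 1 := Nat.odd_iff.1 (hq ▸ hp.pow)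
  have hchar : ringChar (GaloisField p k) ≠ 2 := by
    rw [ringChar.eq (GaloisField p k) p]
    rintro rfl
    exact absurd hp (by decide)
  have hsq : IsSquare (2 : GaloisField p k) ↔ q % 8 = 1 ∨ q % 8 = 7 := by
    rw [FiniteField.isSquare_two_iff, hcard]
    omega
  rw [← hsq]
  constructor
  · rintro ⟨S, ⟨e⟩⟩
    refine PSL2.isSquare_two_of_orderOf_eq_four (x := (e.symm (finRotate 4) : PSL2 _)) ?_
    rw [Subgroup.orderOf_coe, MulEquiv.orderOf_eq, (isCycle_finRotate (n := 2)).orderOf,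
      support_finRotate, Finset.card_univ, Fintype.card_fin]
  · intro hs
    obtain ⟨a, b, hab⟩ := FiniteField.exists_root_sum_quadratic
      (f := (Polynomial.X ^ 2 : Polynomial (GaloisField p k))) (g := Polynomial.X ^ 2 + 1)
      (by simp) (by compute_degree!) (by rw [hcard]; exact hodd)
    refine PSL2.exists_subgroup_equiv_perm (a := a) (b := b) (Ring.two_ne_zero hchar) ?_ hs
    simp at hab
    linear_combination hab
end

section
/- Let q be an odd prime power. Then PSL₂(𝔽_q) contains a subgroup isomorphic to the alternating group on 4 letters. -/
open Matrix

/-- The identification of `Fin 4` (a Klein four-group under bitwise xor) with the subgroup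
generated by two commuting involutions `i`, `j`. -/
def kleinFour {G : Type*} [Group G] (i j : G) : Fin 4 → G := ![1, i, j, i * j]

/-- The 3-cycle `1 ↦ 2 ↦ 3 ↦ 1`, an automorphism of `Fin 4` under bitwise xor. -/
def kleinRotation : Fin 4 → Fin 4 := ![0, 2, 3, 1]

/-- The exponent `e < 3` for which an even permutation `σ` of `Fin 4` is
`t ↦ σ 0 ^^^ kleinRotation^[e] t`. -/
def rotationExponent (σ : alternatingGroup (Fin 4)) : ℕ :=
  ((σ : Equiv.Perm (Fin 4)) 0 ^^^ (σ : Equiv.Perm (Fin 4)) 1).val - 1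

theorem alternatingGroup_mul_apply_zero : ∀ σ τ : alternatingGroup (Fin 4),
    (σ * τ : Equiv.Perm (Fin 4)) 0 = (σ : Equiv.Perm (Fin 4)) 0 ^^^
      kleinRotation^[rotationExponent σ] ((τ : Equiv.Perm (Fin 4)) 0) := by
  decide +kernel

theorem rotationExponent_mul : ∀ σ τ : alternatingGroup (Fin 4),
    rotationExponent (σ * τ) % 3 = (rotationExponent σ + rotationExponent τ) % 3 := by
  decide +kernel

theorem rotationExponent_lt : ∀ σ : alternatingGroup (Fin 4), rotationExponent σ < 3 := by
  decide +kernel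

theorem eq_one_of_rotationExponent_eq_zero : ∀ σ : alternatingGroup (Fin 4),
    (σ : Equiv.Perm (Fin 4)) 0 = 0 → rotationExponent σ = 0 → σ = 1 := by
  decide +kernel

section Abstract

variable {G : Type*} [Group G] {i j x : G}

theorem kleinFour_xor (hi : i * i = 1) (hj : j * j = 1) (hij : i * j = j * i) (a b : Fin 4) :
    kleinFour i j (a ^^^ b) = kleinFour i j a * kleinFour i j b := by
  have hi' (g : G) : i * (i * g) = g := by rw [← mul_assoc, hi, one_mul]
  have hij' (g : G) : j * (i * g) = i * (j * g) := by rw [← mul_assoc, ← hij, mul_assoc]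
  fin_cases a <;> fin_cases b <;>
    simp [kleinFour, hi, hj, hi', mul_assoc, ← hij, hij']

theorem pow_mul_kleinFour (hj : j * j = 1) (hij : i * j = j * i)
    (hxi : x * i = j * x) (hxj : x * j = i * j * x) (n : ℕ) (a : Fin 4) :
    x ^ n * kleinFour i j a = kleinFour i j (kleinRotation^[n] a) * x ^ n := by
  have key (b : Fin 4) : x * kleinFour i j b = kleinFour i j (kleinRotation b) * x := by
    have hxij : x * (i * j) = i * x := by
      rw [← mul_assoc, hxi, mul_assoc, hxj, ← mul_assoc, ← mul_assoc, ← hij, mul_assoc i j j,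
        hj, mul_one]
    fin_cases b
    · simp [kleinFour, kleinRotation]
    · simpa [kleinFour, kleinRotation] using hxi
    · simpa [kleinFour, kleinRotation] using hxj
    · simpa [kleinFour, kleinRotation] using hxij
  induction n generalizing a with
  | zero => simp
  | succ n ih =>
    rw [pow_succ, mul_assoc, key, ← mul_assoc, ih, mul_assoc, Function.iterate_succ_apply]

/-- A group containing commuting `i`, `j` with `i ^ 2 = j ^ 2 = 1`, `i ≠ 1`, and an element `x` with
`x ^ 3 = 1` permuting `i`, `j`, `i * j` cyclically contains the alternating group `Alt₄`. -/
theorem exists_subgroup_mulEquiv_alternatingGroup (hi : i * i = 1) (hj : j * j = 1)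
    (hij : i * j = j * i) (hx : x ^ 3 = 1) (hxi : x * i = j * x) (hxj : x * j = i * j * x)
    (hne : i ≠ 1) : ∃ S : Subgroup G, Nonempty (S ≃* alternatingGroup (Fin 4)) := by
  let φ : alternatingGroup (Fin 4) →* G := MonoidHom.mk'
    (fun σ ↦ kleinFour i j ((σ : Equiv.Perm (Fin 4)) 0) * x ^ rotationExponent σ) fun σ τ ↦ by
      rw [Subgroup.coe_mul, alternatingGroup_mul_apply_zero, kleinFour_xor hi hj hij,
        pow_eq_pow_mod _ hx, rotationExponent_mul, ← pow_eq_pow_mod _ hx, pow_add, mul_assoc,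
        ← mul_assoc (kleinFour i j (kleinRotation^[_] _)),
        ← pow_mul_kleinFour hj hij hxi hxj]
      simp only [mul_assoc]
  have hj1 : j ≠ 1 := fun h ↦ hne (by simpa [h] using hxi)
  have hij1 : i * j ≠ 1 := fun h ↦ hj1 (by simpa [h] using hxj)
  have hzero (a : Fin 4) (h : kleinFour i j a = 1) : a = 0 := by
    fin_cases a <;> simp_all [kleinFour]
  have hx1 : x ≠ 1 := fun h ↦ hne (by simpa [h] using hxj)
  have hinj : Function.Injective φ := by
    rw [injective_iff_map_eq_one]
    intro σ hσ
    change kleinFour i j ((σ : Equiv.Perm (Fin 4)) 0) * x ^ rotationExponent σ = 1 at hσ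
    set a := (σ : Equiv.Perm (Fin 4)) 0
    have hv : kleinFour i j a * kleinFour i j a = 1 := by
      rw [← kleinFour_xor hi hj hij]
      simp [kleinFour]
    have hve : kleinFour i j a = x ^ rotationExponent σ := by
      rw [eq_inv_of_mul_eq_one_right hv, eq_comm]
      exact eq_inv_of_mul_eq_one_right hσ
    have he : x ^ rotationExponent σ = 1 := by
      have h2 : x ^ rotationExponent σ * x ^ rotationExponent σ = 1 := by rwa [← hve]
      have h3 : (x ^ rotationExponent σ) ^ 3 = 1 := by rw [← pow_mul', pow_mul, hx, one_pow]
      rwa [pow_succ, pow_two, h2, one_mul] at h3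
    refine eq_one_of_rotationExponent_eq_zero σ (hzero a (hve.trans he)) ?_
    have hlt := rotationExponent_lt σ
    rw [← orderOf_dvd_iff_pow_eq_one, orderOf_eq_prime hx hx1] at he
    exact Nat.eq_zero_of_dvd_of_lt he hlt
  exact ⟨φ.range, ⟨(MonoidHom.ofInjective hinj).symm⟩⟩

end Abstract

theorem PSL2.mk_neg {F : Type*} [Field F] (A : SpecialLinearGroup (Fin 2) F) :
    ((-A : SpecialLinearGroup (Fin 2) F) : PSL2 F) = A := by
  rw [QuotientGroup.eq, Subgroup.mem_center_iff]
  intro B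
  ext : 1
  simp

/-- A solution of `a ^ 2 + b ^ 2 = -1` makes the quaternion units `i`, `j` and
`-(1 + i + j + i * j) / 2` into elements of `SL₂(F)`, whose images generate `Alt₄`. -/
theorem PSL2.exists_subgroup_mulEquiv_alternatingGroup {F : Type*} [Field F] (h2 : (2 : F) ≠ 0)
    {a b : F} (hab : a ^ 2 + b ^ 2 = -1) :
    ∃ S : Subgroup (PSL2 F), Nonempty (S ≃* alternatingGroup (Fin 4)) := by
  obtain ⟨I, hIc⟩ : ∃ I : SpecialLinearGroup (Fin 2) F, I.1 = !![a, b; b, -a] :=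
    ⟨⟨_, by rw [det_fin_two_of]; linear_combination -hab⟩, rfl⟩
  obtain ⟨J, hJc⟩ : ∃ J : SpecialLinearGroup (Fin 2) F, J.1 = !![0, 1; -1, 0] :=
    ⟨⟨_, by simp [det_fin_two_of]⟩, rfl⟩
  obtain ⟨X, hXc⟩ : ∃ X : SpecialLinearGroup (Fin 2) F,
      X.1 = !![-(1 + a - b) / 2, -(b + 1 + a) / 2; -(b - 1 + a) / 2, -(1 - a + b) / 2] :=
    ⟨⟨_, by rw [det_fin_two_of]; field_simp; linear_combination (-2) * hab⟩, rfl⟩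
  have hI : I * I = -1 := by
    ext r s
    fin_cases r <;> fin_cases s <;>
      simp [hIc] <;> field_simp <;> grind
  have hJ : J * J = -1 := by
    ext r s
    fin_cases r <;> fin_cases s <;> simp [hJc]
  have hIJ : I * J = -(J * I) := by
    ext r s
    fin_cases r <;> fin_cases s <;> simp [hIc, hJc]
  have hXI : X * I = J * X := by
    ext r s
    fin_cases r <;> fin_cases s <;>
      simp [hIc, hJc, hXc] <;> field_simp <;> grind
  have hXJ : X * J = I * J * X := by
    ext r s
    fin_cases r <;> fin_cases s <;>
      simp [hIc, hJc, hXc] <;> field_simp <;> grind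
  have hX : X ^ 3 = 1 := by
    ext r s
    fin_cases r <;> fin_cases s <;>
      simp [hXc, pow_succ] <;> field_simp <;> grind
  let π := QuotientGroup.mk' (Subgroup.center (SpecialLinearGroup (Fin 2) F))
  have hπ (A : SpecialLinearGroup (Fin 2) F) : π (-A) = π A := PSL2.mk_neg A
  refine _root_.exists_subgroup_mulEquiv_alternatingGroup (i := π I) (j := π J) (x := π X)
    ?_ ?_ ?_ ?_ ?_ ?_ ?_
  · rw [← map_mul, hI, hπ, map_one]
  · rw [← map_mul, hJ, hπ, map_one]
  · rw [← map_mul, hIJ, hπ, map_mul]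
  · rw [← map_pow, hX, map_one]
  · rw [← map_mul, hXI, map_mul]
  · rw [← map_mul, hXJ, map_mul, map_mul]
  · intro h
    have hcomm := Subgroup.mem_center_iff.mp ((QuotientGroup.eq_one_iff I).mp h) J
    have h00 := congrArg (fun A : SpecialLinearGroup (Fin 2) F ↦ A.1 0 0) hcomm
    have h01 := congrArg (fun A : SpecialLinearGroup (Fin 2) F ↦ A.1 0 1) hcomm
    simp [hIc, hJc] at h00 h01
    grind

/-- `PSL₂(𝔽_q)`, `q` an odd prime power, contains a subgroup isomorphic to the
alternating group `Alt₄`. -/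
theorem alt4_subgroup_PSL2
    (p : ℕ) [Fact p.Prime] (hp : Odd p) (k : ℕ) (hk : 0 < k) :
    ∃ S : Subgroup (PSL2 (GaloisField p k)),
      Nonempty (S ≃* alternatingGroup (Fin 4)) := by
  obtain ⟨a, b, hab⟩ := CharP.sq_add_sq (GaloisField p k) p (-1)
  refine PSL2.exists_subgroup_mulEquiv_alternatingGroup (Ring.two_ne_zero ?_)
    (a := a) (b := b) (by simpa using hab)
  rw [ringChar.eq (GaloisField p k) p]
  rintro rfl
  exact absurd hp (by decide)
end

section
/- Let q be an odd prime power and let G = PGL₂(𝔽_q). Then every involution of G has centralizer of cardinality 2(q−1) or 2(q+1); involutions whose centralizers have the same cardinality are conjugate in G; and both cardinalities occur, so the involutions of G form exactly two conjugacy classes. -/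
open Matrix

namespace PGL2

variable {F : Type*} [Field F]

lemma mk_eq_mk_iff_exists_smul (g h : GL (Fin 2) F) :
    (g : PGL2 F) = (h : PGL2 F) ↔
      ∃ u : F, (h : Matrix (Fin 2) (Fin 2) F) = u • (g : Matrix (Fin 2) (Fin 2) F) := by
  rw [QuotientGroup.eq, GeneralLinearGroup.mem_center_iff_val_mem_range_scalar]
  constructor
  · rintro ⟨u, hu⟩
    refine ⟨u, ?_⟩
    have h1 : h = g * (g⁻¹ * h) := by group
    rw [h1, Units.val_mul, ← hu, Matrix.scalar_apply, ← Matrix.smul_eq_mul_diagonal]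
  · rintro ⟨u, hu⟩
    refine ⟨u, ?_⟩
    rw [Units.val_mul, hu, Matrix.mul_smul, ← Units.val_mul, inv_mul_cancel, Units.val_one,
      Matrix.scalar_apply, Matrix.smul_one_eq_diagonal]

/-- The matrix `!![0, c; 1, 0]`, whose square is the scalar matrix `c`. -/
def antidiag (c : F) (hc : c ≠ 0) : GL (Fin 2) F :=
  GeneralLinearGroup.mkOfDetNeZero !![0, c; 1, 0] (by simpa [det_fin_two] using hc)

lemma coe_antidiag (c : F) (hc : c ≠ 0) :
    (antidiag c hc : Matrix (Fin 2) (Fin 2) F) = !![0, c; 1, 0] := rfl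

lemma orderOf_antidiag (c : F) (hc : c ≠ 0) : orderOf (antidiag c hc : PGL2 F) = 2 := by
  apply orderOf_eq_prime
  · rw [← QuotientGroup.mk_pow, ← QuotientGroup.mk_one, eq_comm, mk_eq_mk_iff_exists_smul]
    refine ⟨c, ?_⟩
    rw [Units.val_pow_eq_pow_val, coe_antidiag, pow_two]
    ext i j
    fin_cases i <;> fin_cases j <;> simp
  · rw [← QuotientGroup.mk_one, Ne, eq_comm, mk_eq_mk_iff_exists_smul]
    rintro ⟨u, hu⟩
    have := congrFun (congrFun hu 1) 0
    simp [coe_antidiag] at this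

lemma isConj_mk_of_mul_eq {A B P : GL (Fin 2) F} {u : F}
    (h : (A : Matrix (Fin 2) (Fin 2) F) * P = u • (P * B : Matrix (Fin 2) (Fin 2) F)) :
    IsConj (A : PGL2 F) (B : PGL2 F) := by
  rw [isConj_iff]
  refine ⟨(P : PGL2 F)⁻¹, ?_⟩
  rw [inv_inv, mul_assoc, inv_mul_eq_iff_eq_mul, ← QuotientGroup.mk_mul, ← QuotientGroup.mk_mul,
    eq_comm, mk_eq_mk_iff_exists_smul]
  exact ⟨u, by simpa using h⟩

lemma exists_isConj_antidiag {i : PGL2 F} (hi : orderOf i = 2) :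
    ∃ (c : F) (hc : c ≠ 0), IsConj i (antidiag c hc : PGL2 F) := by
  obtain ⟨A, rfl⟩ := QuotientGroup.mk_surjective i
  have h2 : ((A : PGL2 F)) ^ 2 = 1 := orderOf_dvd_iff_pow_eq_one.1 hi.dvd
  have h1 : (A : PGL2 F) ≠ 1 := fun h ↦ by simp [h] at hi
  rw [← QuotientGroup.mk_pow, ← QuotientGroup.mk_one, eq_comm, mk_eq_mk_iff_exists_smul] at h2
  rw [← QuotientGroup.mk_one, Ne, eq_comm, mk_eq_mk_iff_exists_smul] at h1
  obtain ⟨u, hu⟩ := h2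
  have hu0 : u ≠ 0 := by
    rintro rfl
    exact (A ^ 2).ne_zero (hu.trans (zero_smul _ _))
  obtain ⟨a, b, c, d, hA⟩ : ∃ a b c d, (A : Matrix (Fin 2) (Fin 2) F) = !![a, b; c, d] :=
    ⟨_, _, _, _, Matrix.eta_fin_two _⟩
  rw [Units.val_pow_eq_pow_val, hA, pow_two] at hu
  have e00 := congrFun (congrFun hu 0) 0
  have e01 := congrFun (congrFun hu 0) 1
  have e10 := congrFun (congrFun hu 1) 0
  have e11 := congrFun (congrFun hu 1) 1
  simp [Matrix.mul_apply, Fin.sum_univ_two] at e00 e01 e10 e11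
  have hv : ∃ x y : F, x * (c * x + d * y) - (a * x + b * y) * y ≠ 0 := by
    by_contra! hv
    have hc : c = 0 := by simpa using hv 1 0
    have hb : b = 0 := by simpa using hv 0 1
    have hd : d = a := by
      have := hv 1 1
      rw [hc, hb] at this
      linear_combination this
    apply h1
    refine ⟨a, ?_⟩
    rw [hA, hc, hb, hd]
    ext i j
    fin_cases i <;> fin_cases j <;> simp
  obtain ⟨x, y, hxy⟩ := hv
  refine ⟨u, hu0, isConj_mk_of_mul_eq (u := 1) (P := GeneralLinearGroup.mkOfDetNeZero
    !![x, a * x + b * y; y, c * x + d * y] (by simpa [det_fin_two] using hxy)) ?_⟩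
  rw [hA, coe_antidiag]
  change !![a, b; c, d] * !![x, a * x + b * y; y, c * x + d * y] =
    (1 : F) • (!![x, a * x + b * y; y, c * x + d * y] * !![0, u; 1, 0])
  ext i j
  fin_cases i <;> fin_cases j <;> simp
  · linear_combination x * e00 + y * e01
  · linear_combination x * e10 + y * e11

lemma isConj_antidiag_of_eq_mul_sq {c d l : F} (hc : c ≠ 0) (hd : d ≠ 0) (hl : c = d * l ^ 2) :
    IsConj (antidiag c hc : PGL2 F) (antidiag d hd : PGL2 F) := by
  have hl0 : l ≠ 0 := by
    rintro rfl
    simp [hc] at hl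
  refine isConj_mk_of_mul_eq (u := l) (P := GeneralLinearGroup.mkOfDetNeZero
    !![l, 0; 0, 1] (by simpa [det_fin_two] using hl0)) ?_
  rw [coe_antidiag, coe_antidiag]
  change !![0, c; 1, 0] * !![l, 0; 0, 1] = l • (!![l, 0; 0, 1] * !![0, d; 1, 0])
  ext i j
  fin_cases i <;> fin_cases j <;> simp
  rw [hl]
  ring

lemma nat_card_center : Nat.card (Subgroup.center (GL (Fin 2) F)) = Nat.card Fˣ := by
  rw [GeneralLinearGroup.center_eq_range_scalar]
  refine (Nat.card_congr (MonoidHom.ofInjective (f := GeneralLinearGroup.scalar (Fin 2))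
    fun u v h ↦ ?_).toEquiv).symm
  have h' : Matrix.scalar (Fin 2) (u : F) = Matrix.scalar (Fin 2) (v : F) := congrArg Units.val h
  exact Units.ext (Matrix.scalar_inj.1 h')

lemma mk_mem_centralizer_antidiag_iff {c : F} (hc : c ≠ 0) (g : GL (Fin 2) F) :
    (g : PGL2 F) ∈ Subgroup.centralizer {(antidiag c hc : PGL2 F)} ↔
      ∃ s : F, s ^ 2 = 1 ∧ g 0 1 = s * c * g 1 0 ∧ g 1 1 = s * g 0 0 := by
  rw [Subgroup.mem_centralizer_singleton_iff, ← QuotientGroup.mk_mul, ← QuotientGroup.mk_mul,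
    mk_eq_mk_iff_exists_smul, Units.val_mul, Units.val_mul, coe_antidiag]
  have hdet : g.det.val ≠ 0 := g.det.ne_zero
  rw [GeneralLinearGroup.val_det_apply] at hdet
  obtain ⟨x, y, z, w, hg⟩ : ∃ x y z w, (g : Matrix (Fin 2) (Fin 2) F) = !![x, y; z, w] :=
    ⟨_, _, _, _, Matrix.eta_fin_two _⟩
  rw [hg, det_fin_two_of] at hdet
  rw [hg]
  simp only [of_apply, cons_val', cons_val_zero, cons_val_one, cons_val_fin_one]
  constructor
  · rintro ⟨s, hs⟩
    have e00 := congrFun (congrFun hs 0) 0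
    have e01 := congrFun (congrFun hs 0) 1
    have e10 := congrFun (congrFun hs 1) 0
    have e11 := congrFun (congrFun hs 1) 1
    simp [Matrix.mul_apply, Fin.sum_univ_two] at e00 e01 e10 e11
    have hw : w = s * x := mul_left_cancel₀ hc (by linear_combination e01)
    refine ⟨s, mul_right_cancel₀ hdet ?_, by linear_combination e11, hw⟩
    linear_combination -s * w * hw - w * e10 + z * e11 + s * z * e00
  · rintro ⟨s, hs, rfl, rfl⟩
    refine ⟨s, ?_⟩
    ext i j
    fin_cases i <;> fin_cases j <;> simp
    · linear_combination -c * z * hs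
    · ring
    · linear_combination -x * hs
    · ring

/-- A parametrization of the matrices whose classes commute with the class of `antidiag c`. -/
def centralizerParam (c : F) (x : Bool × {x : F × F // x.1 ^ 2 - c * x.2 ^ 2 ≠ 0}) :
    GL (Fin 2) F :=
  GeneralLinearGroup.mkOfDetNeZero
    !![x.2.1.1, (bif x.1 then 1 else -1) * c * x.2.1.2;
      x.2.1.2, (bif x.1 then 1 else -1) * x.2.1.1] (by
    obtain ⟨b, ⟨y, z⟩, h⟩ := x
    rw [det_fin_two_of]
    cases b
    · intro h'
      apply h
      simp at h' ⊢
      linear_combination -h'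
    · intro h'
      apply h
      simp at h' ⊢
      linear_combination h')

lemma nat_card_centralizer_antidiag_mul (h2 : (2 : F) ≠ 0) {c : F} (hc : c ≠ 0) :
    Nat.card Fˣ * Nat.card (Subgroup.centralizer {(antidiag c hc : PGL2 F)}) =
      2 * Nat.card {x : F × F // x.1 ^ 2 - c * x.2 ^ 2 ≠ 0} := by
  have e := Nat.card_congr (QuotientGroup.preimageMkEquivSubgroupProdSet
    (Subgroup.center (GL (Fin 2) F))
    (Subgroup.centralizer {(antidiag c hc : PGL2 F)} : Set (PGL2 F)))
  rw [Nat.card_prod, nat_card_center] at e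
  refine e.symm.trans ?_
  have hb : Nat.card Bool = 2 := by simp
  have hmem (x) : ((centralizerParam c x : GL (Fin 2) F) : PGL2 F) ∈
      Subgroup.centralizer {(antidiag c hc : PGL2 F)} := by
    rw [mk_mem_centralizer_antidiag_iff]
    refine ⟨bif x.1 then 1 else -1, ?_, rfl, rfl⟩
    cases x.1 <;> simp
  refine Eq.trans ?_ (congrArg (· * _) hb)
  refine Eq.trans ?_ (Nat.card_prod _ _)
  refine (Nat.card_congr (Equiv.ofBijective
    (fun x ↦ ⟨centralizerParam c x, hmem x⟩) ⟨?_, ?_⟩)).symm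
  · rintro ⟨b, ⟨y, z⟩, h⟩ ⟨b', ⟨y', z'⟩, h'⟩ heq
    have heq := congrArg Units.val (Subtype.ext_iff.1 heq)
    have e00 : y = y' := congrFun (congrFun heq 0) 0
    have e10 : z = z' := congrFun (congrFun heq 1) 0
    have e01 : (bif b then 1 else -1) * c * z = (bif b' then 1 else -1) * c * z' :=
      congrFun (congrFun heq 0) 1
    have e11 : (bif b then 1 else -1) * y = (bif b' then 1 else -1) * y' :=
      congrFun (congrFun heq 1) 1
    subst e00 e10
    have key : c * z = -(c * z) → y = -y → False := by
      intro h3 h4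
      have hz : z = 0 := by
        have : (2 * c) * z = 0 := by linear_combination h3
        simpa [h2, hc] using this
      have hy : y = 0 := by
        have : 2 * y = 0 := by linear_combination h4
        simpa [h2] using this
      simp [hz, hy] at h
    cases b <;> cases b' <;> simp at e01 e11 ⊢
    · exact key (by linear_combination -e01) (by linear_combination -e11)
    · exact key (by linear_combination e01) (by linear_combination e11)
  · rintro ⟨g, hg⟩
    change (g : PGL2 F) ∈ Subgroup.centralizer _ at hg
    rw [mk_mem_centralizer_antidiag_iff] at hg
    obtain ⟨s, hs, h01, h11⟩ := hg
    have hdet : g.det.val ≠ 0 := g.det.ne_zero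
    rw [GeneralLinearGroup.val_det_apply, det_fin_two, h01, h11] at hdet
    obtain ⟨b, rfl⟩ : ∃ b : Bool, s = bif b then 1 else -1 := by
      rcases sq_eq_one_iff.1 hs with h | h
      · exact ⟨true, h⟩
      · exact ⟨false, h⟩
    refine ⟨⟨b, ⟨g 0 0, g 1 0⟩, ?_⟩, ?_⟩
    · intro h
      apply hdet
      simp only at h
      linear_combination (bif b then 1 else -1) * h
    · apply Subtype.ext
      apply Units.ext
      refine Eq.trans ?_ (Matrix.eta_fin_two _).symm
      rw [h01, h11]
      rfl

lemma nat_card_sq_sub_sq_ne_zero (h2 : (2 : F) ≠ 0) :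
    Nat.card {x : F × F // x.1 ^ 2 - 1 * x.2 ^ 2 ≠ 0} = Nat.card Fˣ * Nat.card Fˣ := by
  rw [← Nat.card_prod]
  have hne (x : Fˣ × Fˣ) : ((x.1 + x.2 : F) / 2) ^ 2 - 1 * ((x.1 - x.2 : F) / 2) ^ 2 ≠ 0 := by
    have : ((x.1 + x.2 : F) / 2) ^ 2 - 1 * ((x.1 - x.2 : F) / 2) ^ 2 = x.1 * x.2 := by
      field_simp
      ring
    rw [this]
    exact mul_ne_zero x.1.ne_zero x.2.ne_zero
  refine (Nat.card_congr (Equiv.ofBijective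
    (fun x : Fˣ × Fˣ ↦ ⟨((x.1 + x.2 : F) / 2, (x.1 - x.2 : F) / 2), hne x⟩) ⟨?_, ?_⟩)).symm
  · rintro ⟨u, v⟩ ⟨u', v'⟩ h
    simp only [Subtype.mk.injEq, Prod.mk.injEq] at h
    obtain ⟨h1, h3⟩ := h
    field_simp at h1 h3
    have hu : (2 : F) * u = 2 * u' := by linear_combination h1 + h3
    have hv : (2 : F) * v = 2 * v' := by linear_combination h1 - h3
    exact Prod.ext (Units.ext (mul_left_cancel₀ h2 hu)) (Units.ext (mul_left_cancel₀ h2 hv))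
  · rintro ⟨⟨y, z⟩, h⟩
    have hp : (y + z) * (y - z) ≠ 0 := fun h' ↦ h (by linear_combination h')
    refine ⟨⟨Units.mk0 _ (left_ne_zero_of_mul hp), Units.mk0 _ (right_ne_zero_of_mul hp)⟩, ?_⟩
    ext <;> simp <;> field_simp <;> ring

lemma nat_card_sq_sub_mul_sq_ne_zero [Finite F] {n : F} (hn : ¬ IsSquare n) :
    Nat.card {x : F × F // x.1 ^ 2 - n * x.2 ^ 2 ≠ 0} = Nat.card F * Nat.card F - 1 := by
  have h (x : F × F) : x.1 ^ 2 - n * x.2 ^ 2 ≠ 0 ↔ x ∈ ({0}ᶜ : Set (F × F)) := by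
    obtain ⟨y, z⟩ := x
    rw [Set.mem_compl_singleton_iff, not_iff_not]
    constructor
    · intro h
      have hz : z = 0 := by
        by_contra hz
        refine hn ⟨y / z, ?_⟩
        field_simp
        linear_combination -h
      simpa [hz] using h
    · intro h
      simp_all
  rw [Nat.card_congr (Equiv.subtypeEquivRight h)]
  change Nat.card ({0}ᶜ : Set (F × F)) = _
  rw [Nat.card_coe_set_eq, Set.ncard_compl, Set.ncard_singleton, Nat.card_prod]

lemma nat_card_centralizer_antidiag_one [Finite F] (h2 : (2 : F) ≠ 0) :
    Nat.card (Subgroup.centralizer {(antidiag (1 : F) one_ne_zero : PGL2 F)}) =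
      2 * (Nat.card F - 1) := by
  have h := nat_card_centralizer_antidiag_mul h2 (one_ne_zero (α := F))
  rw [nat_card_sq_sub_sq_ne_zero h2] at h
  rw [← Nat.card_units]
  refine Nat.eq_of_mul_eq_mul_left (Nat.card_pos (α := Fˣ)) ?_
  rw [h]
  ring

lemma nat_card_centralizer_antidiag_of_not_isSquare [Finite F] (h2 : (2 : F) ≠ 0) {n : F}
    (hn : ¬ IsSquare n) (hn0 : n ≠ 0) :
    Nat.card (Subgroup.centralizer {(antidiag n hn0 : PGL2 F)}) = 2 * (Nat.card F + 1) := by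
  have h := nat_card_centralizer_antidiag_mul h2 hn0
  rw [nat_card_sq_sub_mul_sq_ne_zero hn] at h
  refine Nat.eq_of_mul_eq_mul_left (Nat.card_pos (α := Fˣ)) ?_
  rw [h, Nat.card_units, ← one_mul 1, Nat.mul_self_sub_mul_self_eq, one_mul]
  ring

lemma nat_card_centralizer_eq_of_isConj {G : Type*} [Group G] {a b : G} (h : IsConj a b) :
    Nat.card (Subgroup.centralizer {a}) = Nat.card (Subgroup.centralizer {b}) := by
  obtain ⟨g, rfl⟩ := isConj_iff.1 h
  refine Nat.card_congr ((MulAut.conj g).toEquiv.subtypeEquiv fun x ↦ ?_)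
  simp only [Subgroup.mem_centralizer_singleton_iff]
  change _ ↔ MulAut.conj g x * MulAut.conj g a = MulAut.conj g a * MulAut.conj g x
  rw [← map_mul, ← map_mul, (MulAut.conj g).injective.eq_iff]

lemma isSquare_div_of_not_isSquare [Finite F] {a b : F} (ha : ¬ IsSquare a) (hb : ¬ IsSquare b) :
    IsSquare (a / b) := by
  classical
  have := Fintype.ofFinite F
  have ha0 : a ≠ 0 := fun h ↦ ha (h ▸ IsSquare.zero)
  have hb0 : b ≠ 0 := fun h ↦ hb (h ▸ IsSquare.zero)
  have hab : IsSquare (a * b) := by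
    rw [← quadraticChar_one_iff_isSquare (mul_ne_zero ha0 hb0), map_mul,
      quadraticChar_neg_one_iff_not_isSquare.2 ha, quadraticChar_neg_one_iff_not_isSquare.2 hb]
    norm_num
  obtain ⟨r, hr⟩ := hab
  refine ⟨r / b, ?_⟩
  field_simp
  linear_combination hr

lemma isConj_antidiag_one_or [Finite F] {n : F} (hn : ¬ IsSquare n) (hn0 : n ≠ 0) {i : PGL2 F}
    (hi : orderOf i = 2) :
    IsConj i (antidiag (1 : F) one_ne_zero : PGL2 F) ∨ IsConj i (antidiag n hn0 : PGL2 F) := by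
  obtain ⟨c, hc, h⟩ := exists_isConj_antidiag hi
  by_cases hs : IsSquare c
  · obtain ⟨r, hr⟩ := hs
    exact .inl (h.trans (isConj_antidiag_of_eq_mul_sq (l := r) _ _ (by rw [hr]; ring)))
  · obtain ⟨r, hr⟩ := isSquare_div_of_not_isSquare hs hn
    refine .inr (h.trans (isConj_antidiag_of_eq_mul_sq (l := r) _ _ ?_))
    rw [pow_two, ← hr, mul_div_cancel₀ _ hn0]

end PGL2

/-- In `G = PGL₂(𝔽_q)`, `q` an odd prime power: every involution has centralizer
of cardinality `2(q-1)` or `2(q+1)`; involutions whose centralizers have the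
same cardinality are conjugate; and both cardinalities occur — so the
involutions form exactly two conjugacy classes. -/
theorem two_classes_of_involutions_PGL2
    (p : ℕ) [Fact p.Prime] (hp : Odd p) (k : ℕ) (hk : 0 < k)
    (q : ℕ) (hq : q = p ^ k) :
    (∀ i : PGL2 (GaloisField p k), orderOf i = 2 →
      Nat.card (Subgroup.centralizer {i} : Subgroup (PGL2 (GaloisField p k))) = 2 * (q - 1) ∨
      Nat.card (Subgroup.centralizer {i} : Subgroup (PGL2 (GaloisField p k))) = 2 * (q + 1)) ∧
    (∀ i j : PGL2 (GaloisField p k), orderOf i = 2 → orderOf j = 2 →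
      Nat.card (Subgroup.centralizer {i} : Subgroup (PGL2 (GaloisField p k))) =
        Nat.card (Subgroup.centralizer {j} : Subgroup (PGL2 (GaloisField p k))) →
      ∃ g : PGL2 (GaloisField p k), g⁻¹ * i * g = j) ∧
    (∃ i : PGL2 (GaloisField p k), orderOf i = 2 ∧
      Nat.card (Subgroup.centralizer {i} : Subgroup (PGL2 (GaloisField p k))) = 2 * (q - 1)) ∧
    (∃ i : PGL2 (GaloisField p k), orderOf i = 2 ∧
      Nat.card (Subgroup.centralizer {i} : Subgroup (PGL2 (GaloisField p k))) = 2 * (q + 1)) := by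
  subst hq
  have hcard : Nat.card (GaloisField p k) = p ^ k := GaloisField.card p k hk.ne'
  have : Finite (GaloisField p k) := Nat.finite_of_card_ne_zero
    (hcard ▸ pow_ne_zero _ (Fact.out : p.Prime).ne_zero)
  have hp2 : p ≠ 2 := by
    rintro rfl
    exact absurd hp (by decide)
  have hchar : ringChar (GaloisField p k) ≠ 2 := by
    rwa [ringChar.eq (GaloisField p k) p]
  have h2 : (2 : GaloisField p k) ≠ 0 := Ring.two_ne_zero hchar
  obtain ⟨n, hn⟩ := FiniteField.exists_nonsquare hchar
  have hn0 : n ≠ 0 := fun h ↦ hn (h ▸ IsSquare.zero)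
  have hone := PGL2.nat_card_centralizer_antidiag_one h2
  have hns := PGL2.nat_card_centralizer_antidiag_of_not_isSquare h2 hn hn0
  rw [hcard] at hone hns
  refine ⟨fun i hi ↦ ?_, fun i j hi hj hij ↦ ?_, ⟨_, PGL2.orderOf_antidiag _ _, hone⟩,
    ⟨_, PGL2.orderOf_antidiag _ _, hns⟩⟩
  · exact (PGL2.isConj_antidiag_one_or hn hn0 hi).imp
      (fun h ↦ (PGL2.nat_card_centralizer_eq_of_isConj h).trans hone)
      (fun h ↦ (PGL2.nat_card_centralizer_eq_of_isConj h).trans hns)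
  · have hconj : IsConj i j := by
      rcases PGL2.isConj_antidiag_one_or hn hn0 hi with h | h <;>
        rcases PGL2.isConj_antidiag_one_or hn hn0 hj with h' | h'
      · exact h.trans h'.symm
      · rw [PGL2.nat_card_centralizer_eq_of_isConj h, PGL2.nat_card_centralizer_eq_of_isConj h',
          hone, hns] at hij
        lia
      · rw [PGL2.nat_card_centralizer_eq_of_isConj h, PGL2.nat_card_centralizer_eq_of_isConj h',
          hone, hns] at hij
        lia
      · exact h.trans h'.symm
    obtain ⟨g, hg⟩ := isConj_iff.1 hconj
    exact ⟨g⁻¹, by rwa [inv_inv]⟩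
end
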